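/- The average of the least quadratic nonresidue over primes exists and equals Σ_{n≥1} p_n/2^n; that is, lim_{x→∞} (1/π(x)) · Σ_{2 < p ≤ x, p prime} n_p = Σ_{n≥1} p_n/2^n = 3.67464…, where the series Σ_{n≥1} p_n/2^n converges. -/

import Mathlib

/-- The least quadratic nonresidue modulo `p`: the smallest positive integer `n`
that is not a square modulo `p` (equivalently, the Legendre symbol `(n|p) = -1`). -/
noncomputable def leastQuadraticNonresidue (p : ℕ) : ℕ :=
  sInf {n : ℕ | 0 < n ∧ ¬ IsSquare (n : ZMod p)}

section
open MeasureTheory Filter Topology Set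

namespace Erd

/-- The Fejér kernel. -/
noncomputable def fej (w : ℝ) : ℝ := if w = 0 then 1 else 2 * (1 - Real.cos w) / w ^ 2

lemma fej_nonneg (w : ℝ) : 0 ≤ fej w := by
  unfold fej
  split_ifs
  · norm_num
  · have := Real.cos_le_one w
    positivity [this]

lemma fej_half {w : ℂ} (hw : w ≠ 0) :
    ∫ t in (0 : ℝ)..1, (1 - (t : ℂ)) * Complex.exp (w * t)
      = (Complex.exp w - 1) / w ^ 2 - 1 / w := by
  have h : ∀ t ∈ uIcc (0 : ℝ) 1, HasDerivAt
      (fun t : ℝ => (1 - (t : ℂ)) * Complex.exp (w * t) / w + Complex.exp (w * t) / w ^ 2)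
      ((1 - (t : ℂ)) * Complex.exp (w * t)) t := by
    intro t _
    have h1 : HasDerivAt (fun t : ℝ => (t : ℂ)) 1 t := Complex.ofRealCLM.hasDerivAt
    have h2 : HasDerivAt (fun t : ℝ => Complex.exp (w * t)) (Complex.exp (w * t) * (w * 1)) t :=
      (h1.const_mul w).cexp
    refine HasDerivAt.congr_deriv
      ((((h1.const_sub 1).mul h2).div_const w).add (h2.div_const (w ^ 2))) ?_
    field_simp
    ring
  rw [intervalIntegral.integral_eq_sub_of_hasDerivAt h]
  · simp
    field_simp
    ring
  · apply Continuous.intervalIntegrable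
    fun_prop

lemma fej_integral (w : ℝ) :
    ∫ t in (-1 : ℝ)..1, ((1 - |t| : ℝ) : ℂ) * Complex.exp (Complex.I * w * t) = fej w := by
  have hc : Continuous fun t : ℝ => ((1 - |t| : ℝ) : ℂ) * Complex.exp (Complex.I * w * t) := by
    fun_prop
  rw [← intervalIntegral.integral_add_adjacent_intervals (b := 0)
    (hc.intervalIntegrable _ _) (hc.intervalIntegrable _ _)]
  have e1 : ∫ t in (-1 : ℝ)..0, ((1 - |t| : ℝ) : ℂ) * Complex.exp (Complex.I * w * t)
      = ∫ t in (0 : ℝ)..1, (1 - (t : ℂ)) * Complex.exp (-(Complex.I * w) * t) := by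
    have := intervalIntegral.integral_comp_neg (a := 0) (b := 1)
      (fun t : ℝ => ((1 - |t| : ℝ) : ℂ) * Complex.exp (Complex.I * w * t))
    rw [neg_zero] at this
    rw [← this]
    apply intervalIntegral.integral_congr
    intro t ht
    rw [uIcc_of_le zero_le_one] at ht
    simp [abs_of_nonneg ht.1]
  have e2 : ∫ t in (0 : ℝ)..1, ((1 - |t| : ℝ) : ℂ) * Complex.exp (Complex.I * w * t)
      = ∫ t in (0 : ℝ)..1, (1 - (t : ℂ)) * Complex.exp ((Complex.I * w) * t) := by
    apply intervalIntegral.integral_congr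
    intro t ht
    rw [uIcc_of_le zero_le_one] at ht
    simp [abs_of_nonneg ht.1]
  rw [e1, e2]
  by_cases hw : w = 0
  · subst hw
    simp only [fej, Complex.ofReal_zero, mul_zero, neg_zero, zero_mul, Complex.exp_zero, mul_one]
    have : ∫ t in (0 : ℝ)..1, (1 - (t : ℂ)) = ((∫ t in (0 : ℝ)..1, (1 - t) : ℝ) : ℂ) := by
      rw [← intervalIntegral.integral_ofReal]; simp
    have h2 : (∫ t in (0 : ℝ)..1, (1 - t)) = 1 / 2 := by
      rw [intervalIntegral.integral_sub (by simp) (by simp)]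
      norm_num
    rw [this, h2]
    simp
    norm_num
  · have hw' : Complex.I * (w : ℂ) ≠ 0 := by simp [hw]
    rw [fej_half hw', fej_half (neg_ne_zero.mpr hw')]
    have hwc : (w : ℂ) ≠ 0 := by exact_mod_cast hw
    have : fej w = 2 * (1 - Real.cos w) / w ^ 2 := by simp [fej, hw]
    rw [this]
    push_cast
    rw [Complex.cos]
    have hI : Complex.I ^ 2 = -1 := Complex.I_sq
    rw [mul_comm (w : ℂ) Complex.I, show -(w : ℂ) * Complex.I = -(Complex.I * w) by ring]
    rw [neg_sq, mul_pow, hI]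
    field_simp
    ring

lemma fej_continuous : Continuous fej := by
  have h : Continuous fun w : ℝ =>
      ∫ t in (-1 : ℝ)..1, ((1 - |t| : ℝ) : ℂ) * Complex.exp (Complex.I * w * t) := by
    apply intervalIntegral.continuous_parametric_intervalIntegral_of_continuous'
    fun_prop
  have h2 : Continuous fun w : ℝ => ((fej w : ℝ) : ℂ) := by
    simpa only [fej_integral] using h
  have := Complex.continuous_re.comp h2
  simpa [Function.comp_def] using this

lemma fej_le_one (w : ℝ) : fej w ≤ 1 := by
  unfold fej
  split_ifs with h
  · norm_num
  · have := Real.one_sub_sq_div_two_le_cos (x := w)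
    rw [div_le_one (by positivity)]
    linarith

lemma fej_le (w : ℝ) : fej w ≤ 5 * (1 + w ^ 2)⁻¹ := by
  have h1 := fej_le_one w
  rw [← div_eq_mul_inv, le_div_iff₀ (by positivity)]
  have : fej w * w ^ 2 ≤ 4 := by
    unfold fej
    split_ifs with h
    · simp [h]
    · have := Real.neg_one_le_cos w
      rw [div_mul_cancel₀ _ (by positivity)]
      linarith
  linarith

lemma fej_integrable : Integrable fej := by
  refine (integrable_inv_one_add_sq.const_mul 5).mono' fej_continuous.aestronglyMeasurable ?_
  filter_upwards with w
  rw [Real.norm_of_nonneg (fej_nonneg w)]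
  exact fej_le w

lemma fej_integral_pos : 0 < ∫ w, fej w := by
  exact integral_pos_of_integrable_nonneg_nonzero (x := 0) fej_continuous fej_integrable fej_nonneg
    (by simp [fej])

end Erd

namespace Erd

lemma key_identity (b : ℝ → ℝ) (hb : Measurable b) (B : ℝ) (hB : ∀ u, |b u| ≤ B) (H : ℂ → ℂ)
    (hL : ∀ s : ℂ, 0 < s.re → ∫ u in Ioi (0 : ℝ), (b u : ℂ) * Complex.exp (-s * u) = H s)
    (δ : ℝ) (hδ : 0 < δ) (l v : ℝ) :
    ∫ u in Ioi (0 : ℝ), (b u : ℂ) * Complex.exp (-δ * u) * (fej (l * (v - u)) : ℂ) =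
    ∫ t in Ioc (-1 : ℝ) 1, ((1 - |t| : ℝ) : ℂ) * Complex.exp (Complex.I * (l * v) * t)
      * H (δ + Complex.I * l * t) := by
  have e1 : ∀ t : ℝ, ((1 - |t| : ℝ) : ℂ) * Complex.exp (Complex.I * (l * v) * t)
      * H (δ + Complex.I * l * t) = ∫ u in Ioi (0 : ℝ),
      ((1 - |t| : ℝ) : ℂ) * Complex.exp (Complex.I * (l * v) * t)
      * ((b u : ℂ) * Complex.exp (-(δ + Complex.I * l * t) * u)) := by
    intro t
    rw [integral_const_mul, hL]
    simpa using hδ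
  simp_rw [e1]
  rw [integral_integral_swap]
  · apply integral_congr_ae
    filter_upwards with u
    rw [← fej_integral, intervalIntegral.integral_of_le (by norm_num), ← integral_const_mul]
    apply integral_congr_ae
    filter_upwards with t
    have : Complex.exp (-(δ + Complex.I * l * t) * u) =
      Complex.exp (-δ * u) * Complex.exp (-(Complex.I * l * t) * u) := by
      rw [← Complex.exp_add]; ring_nf
    rw [this]
    have : Complex.exp (Complex.I * ↑(l * (v - u)) * t) =
      Complex.exp (Complex.I * (l * v) * t) * Complex.exp (-(Complex.I * l * t) * u) := by
      rw [← Complex.exp_add]; push_cast; ring_nf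
    rw [this]
    ring
  · have hIntB : Integrable (fun u : ℝ => B * Real.exp (-δ * u)) (volume.restrict (Ioi 0)) :=
      (integrableOn_exp_mul_Ioi (by linarith) 0).const_mul B
    have hone : Integrable (fun _ : ℝ => (1 : ℝ)) (volume.restrict (Ioc (-1 : ℝ) 1)) := by
      simp
    have hg := hone.mul_prod hIntB
    refine hg.mono' ?_ ?_
    · apply Measurable.aestronglyMeasurable
      simp only [Function.uncurry_def]
      fun_prop
    · rw [Measure.prod_restrict]
      refine (ae_restrict_iff' (measurableSet_Ioc.prod measurableSet_Ioi)).mpr ?_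
      filter_upwards with p hp
      simp only [Function.uncurry_def, norm_mul, Complex.norm_exp, Complex.norm_real]
      have h1 : ‖1 - |p.1|‖ ≤ 1 := by
        have : |p.1| ≤ 1 := abs_le.mpr ⟨hp.1.1.le, hp.1.2⟩
        have h0 := abs_nonneg p.1
        rw [Real.norm_eq_abs, abs_le]; constructor <;> linarith
      have h2 : (Complex.I * (l * v) * p.1).re = 0 := by simp
      have h3 : (-(δ + Complex.I * l * p.1) * p.2).re = -δ * p.2 := by simp
      rw [h2, h3, Real.exp_zero, mul_one]
      gcongr
      exact hB _

lemma key_limit (b : ℝ → ℝ) (hb : Measurable b) (B : ℝ) (hB : ∀ u, |b u| ≤ B) (H : ℂ → ℂ)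
    (hH : ContinuousOn H {s | 0 ≤ s.re})
    (hL : ∀ s : ℂ, 0 < s.re → ∫ u in Ioi (0 : ℝ), (b u : ℂ) * Complex.exp (-s * u) = H s)
    (l v : ℝ) (hl : 0 < l) :
    ((∫ u in Ioi (0 : ℝ), b u * fej (l * (v - u)) : ℝ) : ℂ) =
    ∫ t in Ioc (-1 : ℝ) 1, ((1 - |t| : ℝ) : ℂ) * Complex.exp (Complex.I * (l * v) * t)
      * H (Complex.I * l * t) := by
  have hB0 : 0 ≤ B := (abs_nonneg _).trans (hB 0)
  have hKint : Integrable (fun u : ℝ => B * fej (l * (v - u))) (volume.restrict (Ioi 0)) := by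
    apply Integrable.restrict
    apply Integrable.const_mul
    have h1 := (fej_integrable.comp_mul_left' hl.ne').comp_sub_left v
    exact h1
  have h1 : Tendsto (fun δ : ℝ => ∫ u in Ioi (0 : ℝ), (b u : ℂ) * Complex.exp (-δ * u) *
      (fej (l * (v - u)) : ℂ)) (𝓝[>] 0)
      (𝓝 (∫ u in Ioi (0 : ℝ), (b u : ℂ) * (fej (l * (v - u)) : ℂ))) := by
    apply tendsto_integral_filter_of_dominated_convergence _ _ _ hKint
    · filter_upwards with u
      have hc : Continuous fun δ : ℝ => (b u : ℂ) * Complex.exp (-δ * u) *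
        (fej (l * (v - u)) : ℂ) := by fun_prop
      have := (hc.tendsto 0).mono_left (nhdsWithin_le_nhds (s := Ioi 0))
      simpa using this
    · filter_upwards with δ
      apply Measurable.aestronglyMeasurable
      have := fej_continuous.measurable
      fun_prop
    · filter_upwards [self_mem_nhdsWithin] with δ hδ
      refine (ae_restrict_iff' measurableSet_Ioi).mpr ?_
      filter_upwards with u hu
      simp only [norm_mul, Complex.norm_exp, Complex.norm_real, Real.norm_of_nonneg (fej_nonneg _)]
      have h3 : (-(δ : ℂ) * u).re = -(δ * u) := by simp
      rw [h3]
      have : Real.exp (-(δ * u)) ≤ 1 := by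
        rw [Real.exp_le_one_iff]
        have := mul_pos (show (0 : ℝ) < δ from hδ) (show (0 : ℝ) < u from hu)
        linarith
      have hbu := hB u
      rw [← Real.norm_eq_abs] at hbu
      calc _ ≤ B * 1 * fej (l * (v - u)) := by
            gcongr; exact fej_nonneg _
        _ = _ := by ring
  have hcpt : IsCompact ((fun p : ℝ × ℝ => (p.1 : ℂ) + Complex.I * l * p.2) ''
      (Icc 0 1 ×ˢ Icc (-1) 1)) :=
    (isCompact_Icc.prod isCompact_Icc).image (by fun_prop)
  obtain ⟨C, hC⟩ := hcpt.exists_bound_of_continuousOn (hH.mono (by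
    rintro _ ⟨p, hp, rfl⟩
    simpa using hp.1.1))
  have h2 : Tendsto (fun δ : ℝ => ∫ t in Ioc (-1 : ℝ) 1, ((1 - |t| : ℝ) : ℂ) *
      Complex.exp (Complex.I * (l * v) * t) * H (δ + Complex.I * l * t)) (𝓝[>] 0)
      (𝓝 (∫ t in Ioc (-1 : ℝ) 1, ((1 - |t| : ℝ) : ℂ) *
      Complex.exp (Complex.I * (l * v) * t) * H (Complex.I * l * t))) := by
    have hcl : ∀ δ : ℝ, 0 ≤ δ → Continuous fun t : ℝ => H (δ + Complex.I * l * t) := by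
      intro δ hδ
      apply hH.comp_continuous (by fun_prop)
      intro t; simpa using hδ
    apply tendsto_integral_filter_of_dominated_convergence (fun _ => C)
    · filter_upwards [self_mem_nhdsWithin] with δ hδ
      have := hcl δ (le_of_lt hδ)
      apply Continuous.aestronglyMeasurable
      exact Continuous.mul (by fun_prop) this
    · have : ∀ᶠ δ : ℝ in 𝓝[>] 0, δ < 1 :=
        nhdsWithin_le_nhds (gt_mem_nhds one_pos)
      filter_upwards [self_mem_nhdsWithin, this] with δ hδ hδ1
      refine (ae_restrict_iff' measurableSet_Ioc).mpr ?_
      filter_upwards with t ht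
      have hc := hC (δ + Complex.I * l * t) ⟨(δ, t), ⟨⟨le_of_lt hδ, hδ1.le⟩, ht.1.le, ht.2⟩, rfl⟩
      simp only [norm_mul, Complex.norm_exp, Complex.norm_real]
      have h1 : ‖1 - |t|‖ ≤ 1 := by
        have : |t| ≤ 1 := abs_le.mpr ⟨ht.1.le, ht.2⟩
        have h0 := abs_nonneg t
        rw [Real.norm_eq_abs, abs_le]; constructor <;> linarith
      have h2 : (Complex.I * (l * v) * t).re = 0 := by simp
      rw [h2, Real.exp_zero, mul_one]
      calc _ ≤ 1 * C := by gcongr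
        _ = C := one_mul C
    · simp
    · filter_upwards with t
      apply Tendsto.const_mul
      have hcw : ContinuousWithinAt H {s | 0 ≤ s.re} (Complex.I * l * t) := hH _ (by simp)
      refine hcw.tendsto.comp (tendsto_nhdsWithin_iff.mpr ⟨?_, ?_⟩)
      · have hc : Continuous fun δ : ℝ => (δ : ℂ) + Complex.I * l * t := by fun_prop
        have := (hc.tendsto 0).mono_left (nhdsWithin_le_nhds (s := Ioi 0))
        simpa using this
      · filter_upwards [self_mem_nhdsWithin] with δ hδ
        simpa using le_of_lt (show (0 : ℝ) < δ from hδ)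
  have h3 := tendsto_nhds_unique (h1.congr' (by
    filter_upwards [self_mem_nhdsWithin] with δ hδ
    exact key_identity b hb B hB H hL δ hδ l v)) h2
  rw [← h3, ← integral_complex_ofReal]
  simp

lemma key_zero (b : ℝ → ℝ) (hb : Measurable b) (B : ℝ) (hB : ∀ u, |b u| ≤ B) (H : ℂ → ℂ)
    (hH : ContinuousOn H {s | 0 ≤ s.re})
    (hL : ∀ s : ℂ, 0 < s.re → ∫ u in Ioi (0 : ℝ), (b u : ℂ) * Complex.exp (-s * u) = H s)
    (l : ℝ) (hl : 0 < l) :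
    Tendsto (fun v => ∫ u in Ioi (0 : ℝ), b u * fej (l * (v - u))) atTop (𝓝 0) := by
  have h1 := Real.tendsto_integral_exp_smul_cocompact
    ((Ioc (-1 : ℝ) 1).indicator fun t : ℝ => ((1 - |t| : ℝ) : ℂ) * H (Complex.I * l * t))
  have h2 : Tendsto (fun v : ℝ => -(l * v / (2 * Real.pi))) atTop (cocompact ℝ) := by
    refine Tendsto.mono_right ?_ atBot_le_cocompact
    apply tendsto_neg_atTop_atBot.comp
    apply Tendsto.atTop_div_const (by positivity)
    exact tendsto_id.const_mul_atTop hl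
  have h3 := h1.comp h2
  rw [← Complex.ofReal_zero] at h3
  have h4 : Tendsto (fun v => ((∫ u in Ioi (0 : ℝ), b u * fej (l * (v - u)) : ℝ) : ℂ))
      atTop (𝓝 ((0 : ℝ) : ℂ)) := by
    refine h3.congr fun v => ?_
    rw [key_limit b hb B hB H hH hL l v hl]
    simp only [Function.comp_apply]
    rw [← integral_indicator measurableSet_Ioc]
    congr 1 with t
    by_cases ht : t ∈ Ioc (-1 : ℝ) 1
    · simp only [indicator_of_mem ht, Circle.smul_def, Real.fourierChar_apply, smul_eq_mul]
      have : (((2 * Real.pi * -(t * -(l * v / (2 * Real.pi))) : ℝ) : ℂ) * Complex.I) =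
          Complex.I * (l * v) * t := by
        have : (2 * Real.pi * -(t * -(l * v / (2 * Real.pi))) : ℝ) = l * v * t := by
          field_simp
        rw [this]; push_cast; ring
      rw [this]; ring
    · simp [indicator_of_notMem ht]
  have := (Complex.continuous_re.tendsto _).comp h4
  simpa [Function.comp_def] using this

end Erd

namespace Erd

lemma fej_tail_lim : Tendsto (fun R : ℝ => ∫ w in (-R)..R, fej w) atTop (𝓝 (∫ w, fej w)) :=
  intervalIntegral_tendsto_integral fej_integrable tendsto_neg_atTop_atBot tendsto_id

lemma fej_shift_int (l : ℝ) (hl : 0 < l) (v : ℝ) : Integrable (fun u => fej (l * (v - u))) :=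
  (fej_integrable.comp_mul_left' hl.ne').comp_sub_left v

lemma fej_shift_integral (l : ℝ) (hl : 0 < l) (v : ℝ) :
    ∫ u, fej (l * (v - u)) = (∫ w, fej w) / l := by
  rw [integral_sub_left_eq_self (fun u => fej (l * u)) volume v,
    Measure.integral_comp_mul_left]
  simp [abs_of_pos hl]
  ring

lemma fej_shift_interval (l : ℝ) (hl : 0 < l) (v e : ℝ) :
    ∫ u in (v - e)..(v + e), fej (l * (v - u)) = (∫ w in (-(l * e))..(l * e), fej w) / l := by
  rw [intervalIntegral.integral_comp_sub_left (fun u => fej (l * u)) v,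
    intervalIntegral.integral_comp_mul_left _ hl.ne']
  simp
  ring_nf

lemma fej_half_lim (l : ℝ) (hl : 0 < l) :
    Tendsto (fun v => ∫ u in Ioi (0 : ℝ), fej (l * (v - u))) atTop (𝓝 ((∫ w, fej w) / l)) := by
  have h := (intervalIntegral_tendsto_integral fej_integrable tendsto_neg_atTop_atBot
    tendsto_id).div_const l
  have h1 : Tendsto (fun v : ℝ => l * v) atTop atTop := tendsto_id.const_mul_atTop hl
  have h2 := h.comp h1
  refine tendsto_of_tendsto_of_tendsto_of_le_of_le' h2 tendsto_const_nhds ?_ ?_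
  · filter_upwards [eventually_ge_atTop 0] with v hv
    have := fej_shift_interval l hl v v
    simp only [Function.comp_apply, id]
    rw [← this, sub_self, intervalIntegral.integral_of_le (by linarith)]
    apply setIntegral_mono_set (fej_shift_int l hl v).integrableOn
    · filter_upwards with u using fej_nonneg _
    · exact Ioc_subset_Ioi_self.eventuallyLE
  · filter_upwards with v
    rw [← fej_shift_integral l hl v]
    exact setIntegral_le_integral (fej_shift_int l hl v) (by filter_upwards with u using fej_nonneg _)

theorem tauber (a : ℝ → ℝ) (hm : Measurable a) (ha0 : ∀ u, 0 ≤ a u) (M : ℝ) (haM : ∀ u, a u ≤ M)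
    (mono : ∀ u v, 0 ≤ u → u ≤ v → a u * Real.exp u ≤ a v * Real.exp v)
    (A : ℝ) (hA : 0 ≤ A) (H : ℂ → ℂ) (hH : ContinuousOn H {s | 0 ≤ s.re})
    (hL : ∀ s : ℂ, 0 < s.re →
      ∫ u in Ioi (0 : ℝ), ((a u - A : ℝ) : ℂ) * Complex.exp (-s * u) = H s) :
    Tendsto a atTop (𝓝 A) := by
  set c := ∫ w, fej w with hc
  have hcpos : 0 < c := fej_integral_pos
  have hM0 : 0 ≤ M := (ha0 0).trans (haM 0)
  have haint : ∀ l, 0 < l → ∀ v, Integrable (fun u => a u * fej (l * (v - u))) := by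
    intro l hl v
    refine ((fej_shift_int l hl v).const_mul M).mono' ?_ ?_
    · have := fej_continuous.measurable
      apply Measurable.aestronglyMeasurable
      fun_prop
    · filter_upwards with u
      rw [norm_mul, Real.norm_of_nonneg (ha0 u), Real.norm_of_nonneg (fej_nonneg _)]
      exact mul_le_mul_of_nonneg_right (haM u) (fej_nonneg _)
  have conv : ∀ l, 0 < l → Tendsto (fun v => ∫ u in Ioi (0 : ℝ), a u * fej (l * (v - u))) atTop
      (𝓝 (A * c / l)) := by
    intro l hl
    have h0 := key_zero (fun u => a u - A) (by fun_prop) (M + A) (fun u => by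
      rw [abs_le]; constructor <;> linarith [ha0 u, haM u]) H hH hL l hl
    have h1 := h0.add ((fej_half_lim l hl).const_mul A)
    rw [zero_add, ← mul_div_assoc] at h1
    refine h1.congr fun v => ?_
    rw [← integral_const_mul, ← integral_add]
    · congr 1 with u; ring
    · have := ((haint l hl v).sub ((fej_shift_int l hl v).const_mul A)).integrableOn (s := Ioi 0)
      refine this.congr ?_
      filter_upwards with u
      simp; ring
    · exact ((fej_shift_int l hl v).const_mul A).integrableOn
  -- bounds on an interval
  have upper : ∀ e l, 0 < e → 0 < l → ∀ v, e < v →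
      a (v - e) * Real.exp (-(2 * e)) * (∫ w in (-(l * e))..(l * e), fej w) ≤
      l * ∫ u in Ioi (0 : ℝ), a u * fej (l * (v - u)) := by
    intro e l he hl v hv
    have h1 : ∫ u in (v - e)..(v + e), a (v - e) * Real.exp (-(2 * e)) * fej (l * (v - u)) ≤
        ∫ u in (v - e)..(v + e), a u * fej (l * (v - u)) := by
      apply intervalIntegral.integral_mono_on (by linarith)
      · exact ((fej_shift_int l hl v).const_mul _).intervalIntegrable
      · exact (haint l hl v).intervalIntegrable
      · intro u hu
        apply mul_le_mul_of_nonneg_right _ (fej_nonneg _)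
        have h2 := mono (v - e) u (by linarith) hu.1
        have h3 : Real.exp (-(2 * e)) * Real.exp u ≤ Real.exp (v - e) := by
          rw [← Real.exp_add]; apply Real.exp_le_exp.mpr; linarith [hu.2]
        have h4 := mul_le_mul_of_nonneg_left h3 (ha0 (v - e))
        have h5 := Real.exp_pos u
        nlinarith
    rw [intervalIntegral.integral_const_mul, fej_shift_interval l hl] at h1
    have h2 : ∫ u in (v - e)..(v + e), a u * fej (l * (v - u)) ≤
        ∫ u in Ioi (0 : ℝ), a u * fej (l * (v - u)) := by
      rw [intervalIntegral.integral_of_le (by linarith)]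
      apply setIntegral_mono_set (haint l hl v).integrableOn
      · filter_upwards with u using mul_nonneg (ha0 u) (fej_nonneg _)
      · apply LE.le.eventuallyLE
        intro u hu
        have := hu.1
        simp only [mem_Ioi]; linarith
    have h3 := mul_le_mul_of_nonneg_left (h1.trans h2) hl.le
    calc _ = _ := by field_simp
      _ ≤ _ := h3
  have lower : ∀ e l, 0 < e → 0 < l → ∀ v, e < v →
      l * (∫ u in Ioi (0 : ℝ), a u * fej (l * (v - u))) ≤
      a (v + e) * Real.exp (2 * e) * (∫ w in (-(l * e))..(l * e), fej w) +
      M * (c - (∫ w in (-(l * e))..(l * e), fej w)) := by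
    intro e l he hl v hv
    have h0 : ∫ u in Ioi (0 : ℝ), a u * fej (l * (v - u)) ≤ ∫ u, a u * fej (l * (v - u)) :=
      setIntegral_le_integral (haint l hl v)
        (by filter_upwards with u using mul_nonneg (ha0 u) (fej_nonneg _))
    rw [← integral_add_compl (s := Ioc (v - e) (v + e)) measurableSet_Ioc (haint l hl v)] at h0
    have h1 : ∫ u in (v - e)..(v + e), a u * fej (l * (v - u)) ≤
      ∫ u in (v - e)..(v + e), a (v + e) * Real.exp (2 * e) * fej (l * (v - u)) := by
      apply intervalIntegral.integral_mono_on (by linarith)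
      · exact (haint l hl v).intervalIntegrable
      · exact ((fej_shift_int l hl v).const_mul _).intervalIntegrable
      · intro u hu
        apply mul_le_mul_of_nonneg_right _ (fej_nonneg _)
        have h2 := mono u (v + e) (by linarith [hu.1]) hu.2
        have h3 : Real.exp (v + e) ≤ Real.exp (2 * e) * Real.exp u := by
          rw [← Real.exp_add]; apply Real.exp_le_exp.mpr; linarith [hu.1]
        have h4 := mul_le_mul_of_nonneg_left h3 (ha0 (v + e))
        have h5 := Real.exp_pos u
        nlinarith
    rw [intervalIntegral.integral_const_mul, fej_shift_interval l hl,
      intervalIntegral.integral_of_le (by linarith)] at h1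
    have h2 : ∫ u in (Ioc (v - e) (v + e))ᶜ, a u * fej (l * (v - u)) ≤
        ∫ u in (Ioc (v - e) (v + e))ᶜ, M * fej (l * (v - u)) := by
      apply setIntegral_mono (haint l hl v).integrableOn
        ((fej_shift_int l hl v).const_mul M).integrableOn
      intro u
      exact mul_le_mul_of_nonneg_right (haM u) (fej_nonneg _)
    rw [integral_const_mul] at h2
    have h3 := integral_add_compl (s := Ioc (v - e) (v + e)) measurableSet_Ioc
      (fej_shift_int l hl v)
    rw [← intervalIntegral.integral_of_le (by linarith), fej_shift_interval l hl,
      fej_shift_integral l hl] at h3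
    have h4 : ∫ u in (Ioc (v - e) (v + e))ᶜ, fej (l * (v - u)) =
      (c - ∫ w in (-(l * e))..(l * e), fej w) / l := by
      rw [sub_div]; linarith
    rw [h4] at h2
    have h5 := mul_le_mul_of_nonneg_left (h0.trans (add_le_add h1 h2)) hl.le
    refine h5.trans (le_of_eq ?_)
    field_simp
  have kap : ∀ e, 0 < e → Tendsto (fun l : ℝ => ∫ w in (-(l * e))..(l * e), fej w) atTop (𝓝 c) := by
    intro e he
    exact fej_tail_lim.comp (tendsto_id.atTop_mul_const he)
  rw [tendsto_order]
  constructor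
  · intro A' hA'
    -- choose e
    have t1 : Tendsto (fun e : ℝ => Real.exp (-(2 * e)) * A) (𝓝[>] 0) (𝓝 A) := by
      have : Continuous fun e : ℝ => Real.exp (-(2 * e)) * A := by fun_prop
      simpa using (this.tendsto 0).mono_left (nhdsWithin_le_nhds (s := Ioi 0))
    obtain ⟨e, he1, he⟩ := ((t1.eventually (lt_mem_nhds hA')).and self_mem_nhdsWithin).exists
    have he : 0 < e := he
    have t2 : Tendsto (fun l : ℝ => Real.exp (-(2 * e)) *
        ((A * c - M * (c - ∫ w in (-(l * e))..(l * e), fej w)) /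
          ∫ w in (-(l * e))..(l * e), fej w)) atTop
        (𝓝 (Real.exp (-(2 * e)) * ((A * c - M * (c - c)) / c))) := by
      apply Tendsto.const_mul
      exact (((kap e he).const_sub c).const_mul M |>.const_sub (A * c)).div (kap e he) hcpos.ne'
    have hval : Real.exp (-(2 * e)) * ((A * c - M * (c - c)) / c) = Real.exp (-(2 * e)) * A := by
      field_simp; ring
    rw [hval] at t2
    obtain ⟨l, ⟨hl1, hl2⟩, hl⟩ := (((t2.eventually (lt_mem_nhds he1)).and
      ((kap e he).eventually (lt_mem_nhds hcpos))).and (eventually_gt_atTop 0)).exists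
    set k := ∫ w in (-(l * e))..(l * e), fej w with hk
    have t3 : Tendsto (fun v => Real.exp (-(2 * e)) *
        ((l * (∫ u in Ioi (0 : ℝ), a u * fej (l * (v - u))) - M * (c - k)) / k)) atTop
        (𝓝 (Real.exp (-(2 * e)) * ((l * (A * c / l) - M * (c - k)) / k))) :=
      ((((conv l hl).const_mul l).sub_const _).div_const _).const_mul _
    rw [show l * (A * c / l) = A * c by field_simp] at t3
    have t4 := (t3.eventually (lt_mem_nhds hl1)).and (eventually_gt_atTop e)
    have t5 := (tendsto_atTop_add_const_right atTop (-e) tendsto_id).eventually t4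
    filter_upwards [t5] with v hv
    simp only [id] at hv
    have := lower e l he hl (v + -e) hv.2
    rw [← hk, neg_add_cancel_right] at this
    refine hv.1.trans_le ?_
    rw [Real.exp_neg, ← div_eq_inv_mul, div_div, div_le_iff₀ (by positivity)]
    linarith
  · intro A' hA'
    have t1 : Tendsto (fun e : ℝ => Real.exp (2 * e) * A) (𝓝[>] 0) (𝓝 A) := by
      have : Continuous fun e : ℝ => Real.exp (2 * e) * A := by fun_prop
      simpa using (this.tendsto 0).mono_left (nhdsWithin_le_nhds (s := Ioi 0))
    obtain ⟨e, he1, he⟩ := ((t1.eventually (gt_mem_nhds hA')).and self_mem_nhdsWithin).exists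
    have he : 0 < e := he
    have t2 : Tendsto (fun l : ℝ => Real.exp (2 * e) *
        (A * c / ∫ w in (-(l * e))..(l * e), fej w)) atTop
        (𝓝 (Real.exp (2 * e) * (A * c / c))) := by
      apply Tendsto.const_mul
      exact tendsto_const_nhds.div (kap e he) hcpos.ne'
    rw [mul_div_cancel_right₀ _ hcpos.ne'] at t2
    obtain ⟨l, ⟨hl1, hl2⟩, hl⟩ := (((t2.eventually (gt_mem_nhds he1)).and
      ((kap e he).eventually (lt_mem_nhds hcpos))).and (eventually_gt_atTop 0)).exists
    set k := ∫ w in (-(l * e))..(l * e), fej w with hk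
    have t3 : Tendsto (fun v => Real.exp (2 * e) *
        (l * (∫ u in Ioi (0 : ℝ), a u * fej (l * (v - u))) / k)) atTop
        (𝓝 (Real.exp (2 * e) * (l * (A * c / l) / k))) :=
      (((conv l hl).const_mul l).div_const _).const_mul _
    rw [show l * (A * c / l) = A * c by field_simp] at t3
    have t4 := (t3.eventually (gt_mem_nhds hl1)).and (eventually_gt_atTop e)
    have t5 := (tendsto_atTop_add_const_right atTop e tendsto_id).eventually t4
    filter_upwards [t5] with v hv
    simp only [id] at hv
    have := upper e l he hl (v + e) hv.2
    rw [← hk, add_sub_cancel_right] at this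
    refine lt_of_le_of_lt ?_ hv.1
    rw [Real.exp_neg] at this
    rw [← mul_div_assoc, le_div_iff₀ hl2]
    have h6 := mul_le_mul_of_nonneg_left this (Real.exp_pos (2 * e)).le
    refine le_trans (le_of_eq ?_) h6
    field_simp

end Erd

namespace Erd

theorem wiener_ikehara (f : ℕ → ℝ) (hf : ∀ n, 0 ≤ f n) (C : ℝ)
    (hC : ∀ n : ℕ, ∑ k ∈ Finset.Icc 1 n, f k ≤ C * n) (A : ℝ) (hA : 0 ≤ A) (G : ℂ → ℂ)
    (hG : ContinuousOn G {s | 1 ≤ s.re})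
    (hGF : ∀ s : ℂ, 1 < s.re → G s = LSeries (fun n => (f n : ℂ)) s - A / (s - 1)) :
    Tendsto (fun n : ℕ => (∑ k ∈ Finset.Icc 1 n, f k) / n) atTop (𝓝 A) := by
  set S : ℕ → ℝ := fun n => ∑ k ∈ Finset.Icc 1 n, f k with hS
  have hS0 : ∀ n, 0 ≤ S n := fun n => Finset.sum_nonneg fun k _ => hf k
  have hSm : Monotone S := by
    intro m n hmn
    exact Finset.sum_le_sum_of_subset_of_nonneg (Finset.Icc_subset_Icc_right hmn)
      (fun k _ _ => hf k)
  have hC0 : 0 ≤ C := by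
    have := (hS0 1).trans (hC 1)
    simpa using this
  set a : ℝ → ℝ := fun u => S ⌊Real.exp u⌋₊ * Real.exp (-u) with ha
  have hm : Measurable a := by
    apply Measurable.mul _ (by fun_prop)
    exact (measurable_from_top (f := S)).comp (Nat.measurable_floor.comp (by fun_prop))
  have haC : ∀ u, a u ≤ C := by
    intro u
    have h1 := hC ⌊Real.exp u⌋₊
    have h2 := Nat.floor_le (Real.exp_pos u).le
    have h3 : S ⌊Real.exp u⌋₊ ≤ C * Real.exp u := h1.trans (by gcongr)
    simp only [ha]
    rw [Real.exp_neg, ← div_eq_mul_inv, div_le_iff₀ (Real.exp_pos u)]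
    exact h3
  have ha0 : ∀ u, 0 ≤ a u := fun u => mul_nonneg (hS0 _) (Real.exp_pos _).le
  have haexp : ∀ u, a u * Real.exp u = S ⌊Real.exp u⌋₊ := by
    intro u; simp only [ha]; rw [mul_assoc, ← Real.exp_add]; simp
  have hO : (fun n ↦ ∑ k ∈ Finset.Icc 1 n, f k) =O[atTop] fun n ↦ (n : ℝ) ^ (1 : ℝ) := by
    apply Asymptotics.IsBigO.of_bound C
    filter_upwards with n
    rw [Real.norm_of_nonneg (hS0 n), Real.rpow_one, Real.norm_of_nonneg (Nat.cast_nonneg n)]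
    exact hC n
  have hmain : Tendsto a atTop (𝓝 A) := by
    apply tauber a hm ha0 C haC _ A hA (fun s => (G (1 + s) - A) / (1 + s))
    · apply ContinuousOn.div
      · apply ContinuousOn.sub _ continuousOn_const
        apply hG.comp (by fun_prop)
        intro s hs
        have : 0 ≤ s.re := hs
        simpa using this
      · fun_prop
      · intro s hs h0
        have : 0 ≤ s.re := hs
        have h1 := congrArg Complex.re h0
        simp at h1
        linarith
    · intro s hs
      have hs0 : s ≠ 0 := by rintro rfl; simp at hs
      have hs1 : (1 : ℂ) + s ≠ 0 := by
        intro h0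
        have h1 := congrArg Complex.re h0
        simp at h1
        linarith
      have hre : 1 < (1 + s).re := by simpa using hs
      have hF := LSeries_eq_mul_integral_of_nonneg f (r := 1) zero_le_one hre hO hf
      have hcv : ∫ t in Ioi (1 : ℝ), (∑ k ∈ Finset.Icc 1 ⌊t⌋₊, (f k : ℂ)) * (t : ℂ) ^ (-((1 + s) + 1))
          = ∫ u in Ioi (0 : ℝ), (a u : ℂ) * Complex.exp (-s * u) := by
        have himg : Real.exp '' Ioi 0 = Ioi 1 := by
          ext t
          constructor
          · rintro ⟨u, hu, rfl⟩
            simpa using hu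
          · intro ht
            have ht : 1 < t := ht
            exact ⟨Real.log t, Real.log_pos ht, Real.exp_log (by linarith)⟩
        rw [← himg, integral_image_eq_integral_abs_deriv_smul measurableSet_Ioi
          (fun u _ => (Real.hasDerivAt_exp u).hasDerivWithinAt) Real.exp_injective.injOn]
        apply integral_congr_ae
        filter_upwards with u
        have h1 : (∑ k ∈ Finset.Icc 1 ⌊Real.exp u⌋₊, (f k : ℂ)) = ((S ⌊Real.exp u⌋₊ : ℝ) : ℂ) := by
          simp [hS]
        rw [h1, abs_of_pos (Real.exp_pos u), Complex.real_smul, ← haexp]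
        rw [Complex.cpow_def_of_ne_zero (by exact_mod_cast (Real.exp_pos u).ne'),
          ← Complex.ofReal_log (Real.exp_pos u).le, Real.log_exp]
        push_cast
        have : Complex.exp u * (a u * Complex.exp u * Complex.exp (u * (-(1 + s + 1)))) =
          a u * (Complex.exp u * Complex.exp u * Complex.exp (u * (-(1 + s + 1)))) := by ring
        rw [this, ← Complex.exp_add, ← Complex.exp_add]
        ring_nf
      rw [hcv] at hF
      have hexpint : IntegrableOn (fun u : ℝ => Complex.exp (-s * u)) (Ioi 0) :=
        integrableOn_exp_mul_complex_Ioi (by simpa using hs) 0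
      have hI : ∫ u in Ioi (0 : ℝ), Complex.exp (-s * u) = 1 / s := by
        rw [integral_exp_mul_complex_Ioi (by simpa using hs)]
        simp
      have hai : IntegrableOn (fun u : ℝ => (a u : ℂ) * Complex.exp (-s * u)) (Ioi 0) := by
        apply Integrable.bdd_mul (c := C) hexpint
        · apply Measurable.aestronglyMeasurable; fun_prop
        · filter_upwards with u
          rw [Complex.norm_real, Real.norm_of_nonneg (ha0 u)]
          exact haC u
      have : ∫ u in Ioi (0 : ℝ), ((a u - A : ℝ) : ℂ) * Complex.exp (-s * u) =
          (∫ u in Ioi (0 : ℝ), (a u : ℂ) * Complex.exp (-s * u)) - A * (1 / s) := by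
        rw [← hI, ← integral_const_mul, ← integral_sub hai (hexpint.const_mul _)]
        congr 1 with u
        push_cast; ring
      rw [this, hGF _ hre, hF, add_sub_cancel_left]
      field_simp
      ring
    · intro u v hu huv
      rw [haexp, haexp]
      apply hSm
      apply Nat.floor_mono
      exact Real.exp_le_exp.mpr huv
  have h1 := hmain.comp (Real.tendsto_log_atTop.comp tendsto_natCast_atTop_atTop)
  refine h1.congr' ?_
  filter_upwards [eventually_gt_atTop 0] with n hn
  have hn' : (0 : ℝ) < n := by exact_mod_cast hn
  simp only [Function.comp_apply, ha]
  rw [Real.exp_neg, Real.exp_log hn', Nat.floor_natCast]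
  rfl

open ArithmeticFunction ArithmeticFunction.vonMangoldt in
theorem pnt_ap (q : ℕ) [NeZero q] (a : ZMod q) (ha : IsUnit a) :
    Tendsto (fun n : ℕ => (∑ k ∈ Finset.Icc 1 n, residueClass a k) / n) atTop
      (𝓝 ((q.totient : ℝ)⁻¹)) := by
  apply wiener_ikehara (residueClass a) (residueClass_nonneg a) (Real.log 4 + 4) _ _
    (by positivity) (LFunctionResidueClassAux a) (continuousOn_LFunctionResidueClassAux a)
  · intro s hs
    rw [eqOn_LFunctionResidueClassAux ha hs]
    push_cast
    rfl
  · intro n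
    have h := Chebyshev.psi_le_const_mul_self (x := n) (Nat.cast_nonneg n)
    refine le_trans ?_ h
    rw [Chebyshev.psi, Nat.floor_natCast]
    apply Finset.sum_le_sum
    intro k _
    exact residueClass_le a k

end Erd

namespace Erd

lemma psi_theta_small : Tendsto (fun n : ℕ => (Chebyshev.psi n - Chebyshev.theta n) / n) atTop (𝓝 0) := by
  obtain ⟨C, hC⟩ := Chebyshev.psi_sub_theta_le_mul_sqrt
  have h2 : Tendsto (fun n : ℕ => C * (Real.sqrt n)⁻¹) atTop (𝓝 0) := by
    have := (tendsto_inv_atTop_zero.comp (Real.tendsto_sqrt_atTop.comp tendsto_natCast_atTop_atTop)).const_mul C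
    simpa [Function.comp_def] using this
  refine squeeze_zero' ?_ ?_ h2
  · filter_upwards with n
    have := Chebyshev.theta_le_psi (n:ℝ)
    exact div_nonneg (by linarith) (by positivity)
  · filter_upwards [eventually_gt_atTop 0] with n hn
    have hn' : (0:ℝ) < n := by exact_mod_cast hn
    rw [div_le_iff₀ hn']
    have := hC n
    have h3 := Real.mul_self_sqrt hn'.le
    have h4 : 0 < Real.sqrt n := Real.sqrt_pos.2 hn'
    calc _ ≤ _ := this
      _ = C * (Real.sqrt n)⁻¹ * (Real.sqrt n * Real.sqrt n) := by field_simp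
      _ = _ := by rw [h3]

lemma pi_theta_small : Tendsto (fun n : ℕ => (Nat.primeCounting n * Real.log n - Chebyshev.theta n) / n) atTop (𝓝 0) := by
  obtain ⟨C, hC⟩ := Chebyshev.primeCounting_sub_theta_div_log_isBigO.bound
  have h1 := tendsto_natCast_atTop_atTop (R := ℝ) |>.eventually hC
  have h2 : Tendsto (fun n : ℕ => C * (Real.log n)⁻¹) atTop (𝓝 0) := by
    have := (tendsto_inv_atTop_zero.comp (Real.tendsto_log_atTop.comp (tendsto_natCast_atTop_atTop (R:=ℝ)))).const_mul C
    simpa [Function.comp_def] using this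
  refine squeeze_zero_norm' ?_ h2
  filter_upwards [h1, eventually_gt_atTop 1] with n h hn
  have hn' : (1:ℝ) < n := by exact_mod_cast hn
  have hl : 0 < Real.log n := Real.log_pos hn'
  simp only [Nat.floor_natCast] at h
  rw [Real.norm_eq_abs, Real.norm_eq_abs, abs_of_nonneg (a := (n:ℝ) / _) (by positivity)] at h
  rw [Real.norm_eq_abs]
  have : (Nat.primeCounting n * Real.log n - Chebyshev.theta n) / n = (Nat.primeCounting n - Chebyshev.theta n / Real.log n) * (Real.log n / n) := by
    field_simp
  rw [this, abs_mul, abs_of_nonneg (a := Real.log n / _) (by positivity)]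
  calc _ ≤ (C * (n / Real.log n ^ 2)) * (Real.log n / n) := by gcongr
    _ = _ := by field_simp

lemma prime_sum_tendsto (c : ℕ → ℝ) (h0 : ∀ n, 0 ≤ c n) (h1 : ∀ n, c n ≤ 1) (A : ℝ)
    (h : Tendsto (fun n : ℕ => (∑ k ∈ Finset.Icc 1 n, ArithmeticFunction.vonMangoldt k * c k) / n) atTop (𝓝 A)) :
    Tendsto (fun n : ℕ => (∑ p ∈ Nat.primesLE n, c p) * Real.log n / n) atTop (𝓝 A) := by
  have key : Tendsto (fun n : ℕ => (∑ p ∈ Nat.primesLE n, c p) * Real.log n / n - (∑ k ∈ Finset.Icc 1 n, ArithmeticFunction.vonMangoldt k * c k) / n) atTop (𝓝 0) := by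
    have hb := psi_theta_small.neg
    rw [neg_zero] at hb
    have hdec : ∀ n : ℕ, (∑ k ∈ Finset.Icc 1 n, ArithmeticFunction.vonMangoldt k * c k) = ∑ p ∈ Nat.primesLE n, Real.log p * c p + ∑ k ∈ Finset.Icc 1 n with ¬ k.Prime, ArithmeticFunction.vonMangoldt k * c k := by
      intro n
      rw [← Finset.sum_filter_add_sum_filter_not (Finset.Icc 1 n) Nat.Prime, Nat.primesLE_eq_filter_Icc_one]
      congr 1
      refine Finset.sum_congr rfl fun p hp => ?_
      rw [ArithmeticFunction.vonMangoldt_apply_prime (Finset.mem_filter.1 hp).2]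
    have hE1 : ∀ n : ℕ, ∑ k ∈ Finset.Icc 1 n with ¬ k.Prime, ArithmeticFunction.vonMangoldt k * c k ≤ Chebyshev.psi n - Chebyshev.theta n := by
      intro n
      rw [Chebyshev.psi_sub_theta_eq_sum_not_prime, Nat.floor_natCast]
      rw [show Finset.Ioc 0 n = Finset.Icc 1 n from rfl]
      refine Finset.sum_le_sum fun k _ => mul_le_of_le_one_right ArithmeticFunction.vonMangoldt_nonneg (h1 k)
    have hE1' : ∀ n : ℕ, 0 ≤ ∑ k ∈ Finset.Icc 1 n with ¬ k.Prime, ArithmeticFunction.vonMangoldt k * c k := by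
      intro n
      exact Finset.sum_nonneg fun k _ => mul_nonneg ArithmeticFunction.vonMangoldt_nonneg (h0 k)
    have hE2 : ∀ n : ℕ, ∑ p ∈ Nat.primesLE n, c p * (Real.log n - Real.log p) ≤ Nat.primeCounting n * Real.log n - Chebyshev.theta n := by
      intro n
      rw [Chebyshev.theta_eq_sum_primesLE_log, ← Nat.primesLE_card_eq_primeCounting, ← nsmul_eq_mul, ← Finset.sum_const, ← Finset.sum_sub_distrib]
      refine Finset.sum_le_sum fun p hp => mul_le_of_le_one_left ?_ (h1 p)
      have := Nat.mem_primesLE.1 hp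
      have h3 : Real.log p ≤ Real.log n := Real.log_le_log (by exact_mod_cast this.2.pos) (by exact_mod_cast this.1)
      linarith
    have hE2' : ∀ n : ℕ, 0 ≤ ∑ p ∈ Nat.primesLE n, c p * (Real.log n - Real.log p) := by
      intro n
      refine Finset.sum_nonneg fun p hp => mul_nonneg (h0 p) ?_
      have := Nat.mem_primesLE.1 hp
      have h3 : Real.log p ≤ Real.log n := Real.log_le_log (by exact_mod_cast this.2.pos) (by exact_mod_cast this.1)
      linarith
    have hid : ∀ n : ℕ, (∑ p ∈ Nat.primesLE n, c p) * Real.log n = ∑ p ∈ Nat.primesLE n, c p * (Real.log n - Real.log p) + ∑ p ∈ Nat.primesLE n, Real.log p * c p := by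
      intro n
      rw [← Finset.sum_add_distrib, Finset.sum_mul]
      refine Finset.sum_congr rfl fun p _ => by ring
    refine tendsto_of_tendsto_of_tendsto_of_le_of_le hb pi_theta_small ?_ ?_
    · intro n
      simp only
      rw [← neg_div, ← sub_div]
      refine div_le_div_of_nonneg_right ?_ (by positivity)
      rw [hid, hdec]
      linarith [hE1 n, hE2' n]
    · intro n
      simp only
      rw [← sub_div]
      refine div_le_div_of_nonneg_right ?_ (by positivity)
      rw [hid, hdec]
      linarith [hE1' n, hE2 n]
  have := key.add h
  simpa using this

lemma pi_asymp : Tendsto (fun n : ℕ => (Nat.primeCounting n : ℝ) * Real.log n / n) atTop (𝓝 1) := by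
  have h := pnt_ap 1 (0 : ZMod 1) (by decide)
  have := prime_sum_tendsto (fun _ => 1) (by simp) (by simp) 1 ?_
  · simpa [Nat.primesLE_card_eq_primeCounting] using this
  · simp only [Nat.totient_one, Nat.cast_one, inv_one] at h
    refine h.congr fun n => ?_
    congr 1
    refine Finset.sum_congr rfl fun k _ => ?_
    have : (k : ZMod 1) = 0 := Subsingleton.elim _ _
    simp [ArithmeticFunction.vonMangoldt.residueClass, Set.indicator, this]

open Classical in
lemma prime_density (q : ℕ) [NeZero q] (S : Finset (ZMod q)ˣ) :
    Tendsto (fun n : ℕ => (((Nat.primesLE n).filter (fun p : ℕ => ∃ u ∈ S, (p : ZMod q) = u)).card : ℝ) / Nat.primeCounting n)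
      atTop (𝓝 (S.card / q.totient)) := by
  classical
  set c : ℕ → ℝ := fun n => if ∃ u ∈ S, (n : ZMod q) = u then 1 else 0 with hc
  have hcs : ∀ k, ArithmeticFunction.vonMangoldt k * c k = ∑ u ∈ S, ArithmeticFunction.vonMangoldt.residueClass (u : ZMod q) k := by
    intro k
    by_cases h : ∃ u ∈ S, (k : ZMod q) = u
    · obtain ⟨u, hu, hk⟩ := h
      have : c k = 1 := if_pos ⟨u, hu, hk⟩
      rw [this, mul_one, Finset.sum_eq_single_of_mem u hu]
      · simp [ArithmeticFunction.vonMangoldt.residueClass, Set.indicator, hk]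
      · intro v _ hv
        have : ¬ ((u : ZMod q) = v) := fun h => hv (Units.ext h.symm)
        simp [ArithmeticFunction.vonMangoldt.residueClass, Set.indicator, hk, this]
    · have : c k = 0 := if_neg h
      rw [this, mul_zero, Finset.sum_eq_zero]
      intro v hv
      have : ¬ ((k : ZMod q) = v) := fun h' => h ⟨v, hv, h'⟩
      simp [ArithmeticFunction.vonMangoldt.residueClass, Set.indicator, this]
  have h := prime_sum_tendsto c (fun n => by simp only [hc]; split_ifs <;> norm_num) (fun n => by simp only [hc]; split_ifs <;> norm_num) (S.card / q.totient) ?_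
  · have h2 := h.div pi_asymp one_ne_zero
    rw [div_one] at h2
    refine h2.congr' ?_
    filter_upwards [eventually_gt_atTop 1] with n hn
    have hn' : (1:ℝ) < n := by exact_mod_cast hn
    have hl : 0 < Real.log n := Real.log_pos hn'
    have : (∑ p ∈ Nat.primesLE n, c p) = (((Nat.primesLE n).filter (fun p : ℕ => ∃ u ∈ S, (p : ZMod q) = u)).card : ℝ) := by
      simp [hc]
    simp only [Pi.div_apply]
    rw [this]
    by_cases h0 : (Nat.primeCounting n : ℝ) = 0
    · simp [h0]
    · field_simp
  · have := tendsto_finsetSum S (fun u _ => pnt_ap q (u : ZMod q) u.isUnit)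
    simp only [Finset.sum_const, nsmul_eq_mul] at this
    rw [div_eq_mul_inv]
    refine this.congr fun n => ?_
    rw [← Finset.sum_div, Finset.sum_comm]
    congr 1
    exact Finset.sum_congr rfl fun k _ => (hcs k).symm

end Erd

namespace Erd

/-- the `k`-th prime, indexed from zero -/
noncomputable def pr (k : ℕ) : ℕ := Nat.nth Nat.Prime k

lemma pr_prime (k : ℕ) : (pr k).Prime := Nat.prime_nth_prime k

lemma pr_strictMono : StrictMono pr := Nat.nth_strictMono Nat.infinite_setOfPred_prime

lemma pr_zero : pr 0 = 2 := Nat.nth_prime_zero_eq_two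

lemma exists_pr {p : ℕ} (hp : p.Prime) : ∃ k, pr k = p :=
  ⟨Nat.count Nat.Prime p, Nat.nth_count hp⟩

lemma pr_eq_two {k : ℕ} (h : pr k = 2) : k = 0 := by
  apply pr_strictMono.injective; rw [h, pr_zero]

/-- modulus -/
noncomputable def qm (k : ℕ) : ℕ := 4 * ∏ i ∈ Finset.range k, pr i

lemma qm_pos (k : ℕ) : 0 < qm k := by
  unfold qm
  have : 0 < ∏ i ∈ Finset.range k, pr i := Finset.prod_pos fun i _ => (pr_prime i).pos
  omega

instance (k : ℕ) : NeZero (qm k) := ⟨(qm_pos k).ne'⟩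

lemma four_dvd_qm (k : ℕ) {i : ℕ} (hi : i < k) : 4 * pr i ∣ qm k :=
  Nat.mul_dvd_mul_left 4 (Finset.dvd_prod_of_mem pr (Finset.mem_range.2 hi))

lemma two_dvd_qm (k : ℕ) : 2 ∣ qm k := ⟨2 * ∏ i ∈ Finset.range k, pr i, by unfold qm; ring⟩

lemma jac_congr {a m n : ℕ} (hm : Odd m) (hn : Odd n) (h : m ≡ n [MOD 4 * a]) : jacobiSym a m = jacobiSym a n := by
  rw [jacobiSym.mod_right' a hm, jacobiSym.mod_right' a hn, h]

lemma unit_odd {q : ℕ} (hq : 2 ∣ q) [NeZero q] (u : (ZMod q)ˣ) : Odd (u : ZMod q).val := by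
  have := ZMod.val_coe_unit_coprime u
  exact (Nat.Coprime.coprime_dvd_right hq this).symm.odd_of_left

/-- the quadratic character attached to `a` -/
noncomputable def jhom (q a : ℕ) [NeZero q] (h2 : 2 ∣ q) (ha : 4 * a ∣ q) : (ZMod q)ˣ →* ℤ where
  toFun u := jacobiSym a (u : ZMod q).val
  map_one' := by
    have h := unit_odd h2 (1 : (ZMod q)ˣ)
    rw [jac_congr (n := 1) h odd_one, jacobiSym.one_right]
    refine Nat.ModEq.of_dvd ha ?_
    rw [← ZMod.natCast_eq_natCast_iff]
    simp
  map_mul' u v := by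
    have hu := unit_odd h2 u
    have hv := unit_odd h2 v
    have : jacobiSym a ((u * v : (ZMod q)ˣ) : ZMod q).val = jacobiSym a ((u : ZMod q).val * (v : ZMod q).val) := by
      refine jac_congr (unit_odd h2 _) (hu.mul hv) ?_
      refine Nat.ModEq.of_dvd ha ?_
      rw [← ZMod.natCast_eq_natCast_iff]
      simp
    rw [this]
    have : NeZero (u : ZMod q).val := ⟨hu.pos.ne'⟩
    have : NeZero (v : ZMod q).val := ⟨hv.pos.ne'⟩
    rw [jacobiSym.mul_right]

noncomputable def jvec (k : ℕ) : (ZMod (qm k))ˣ →* (Fin k → ℤˣ) :=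
  MonoidHom.pi fun i => (jhom (qm k) (pr i) (two_dvd_qm k) (four_dvd_qm k i.2)).toHomUnits

lemma jvec_apply (k : ℕ) (u : (ZMod (qm k))ˣ) (i : Fin k) :
    ((jvec k u i : ℤˣ) : ℤ) = jacobiSym (pr i) (u : ZMod (qm k)).val := rfl

lemma jvec_cast (k : ℕ) (u : (ZMod (qm k))ˣ) (i : Fin k) (n : ℕ) (h : (n : ZMod (qm k)) = u) :
    ((jvec k u i : ℤˣ) : ℤ) = jacobiSym (pr i) n := by
  rw [jvec_apply]
  have h1 := unit_odd (two_dvd_qm k) u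
  have hmod : (u : ZMod (qm k)).val ≡ n [MOD qm k] := by
    rw [← ZMod.natCast_eq_natCast_iff, h]; simp
  have h2 : Odd n := by
    have := hmod.of_dvd (two_dvd_qm k)
    rw [Nat.odd_iff] at *
    rw [← this, h1]
  exact jac_congr h1 h2 (hmod.of_dvd (four_dvd_qm k i.2))

lemma exists_sign (k i : ℕ) (hi : i < k) : ∃ n : ℕ, n.Coprime (qm k) ∧ jacobiSym (pr i) n = -1 ∧
    ∀ j < k, j ≠ i → jacobiSym (pr j) n = 1 := by
  set M := ∏ j ∈ (Finset.range k).erase i, pr j with hM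
  have hq : qm k = 4 * (pr i * M) := by
    rw [hM, Finset.mul_prod_erase _ _ (Finset.mem_range.2 hi)]; rfl
  have hcop : ∀ j, j ≠ i → (pr i).Coprime (pr j) := fun j hj =>
    (Nat.coprime_primes (pr_prime i) (pr_prime j)).2 fun h => hj (pr_strictMono.injective h).symm
  have hcM : (pr i).Coprime M := Nat.Coprime.prod_right fun j hj => hcop j (Finset.mem_erase.1 hj).1
  have hdvd : ∀ j < k, j ≠ i → pr j ∣ M := fun j hj hji =>
    Finset.dvd_prod_of_mem pr (Finset.mem_erase.2 ⟨hji, Finset.mem_range.2 hj⟩)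
  by_cases h2 : pr i = 2
  · have h8M : Nat.Coprime 8 M := by
      rw [h2] at hcM
      exact Nat.Coprime.pow_left 3 hcM
    obtain ⟨n, hn8, hnM⟩ := Nat.chineseRemainder h8M 5 1
    have hodd : Odd n := by
      have : n % 8 = 5 := hn8
      rw [Nat.odd_iff]; omega
    have h4 : n ≡ 1 [MOD 4] := by
      have : n % 8 = 5 := hn8
      show n % 4 = 1; omega
    refine ⟨n, ?_, ?_, ?_⟩
    · rw [hq, h2, ← mul_assoc]
      refine Nat.Coprime.mul_right ?_ ?_
      · exact Nat.Coprime.pow_right 3 (Nat.coprime_two_right.2 hodd)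
      · rw [Nat.Coprime, hnM.gcd_eq]; simp
    · rw [h2]
      rw [Nat.cast_ofNat, jacobiSym.at_two hodd]
      have : ((n : ℕ) : ZMod 8) = ((5 : ℕ) : ZMod 8) := (ZMod.natCast_eq_natCast_iff _ _ _).2 hn8
      rw [this]; decide
    · intro j hj hji
      rw [jac_congr (n := 1) hodd odd_one, jacobiSym.one_right]
      refine (Nat.modEq_and_modEq_iff_modEq_mul ?_).1 ⟨h4, hnM.of_dvd (hdvd j hj hji)⟩
      have := hcop j hji
      rw [h2] at this
      exact Nat.Coprime.pow_left 2 this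
  · have hodd' : Odd (pr i) := (pr_prime i).odd_of_ne_two h2
    have : Fact (pr i).Prime := ⟨pr_prime i⟩
    have hc4 : (4 * M).Coprime (pr i) := by
      refine Nat.Coprime.mul_left ?_ hcM.symm
      exact Nat.Coprime.pow_left 2 (Nat.coprime_two_left.2 hodd')
    obtain ⟨a, ha⟩ := FiniteField.exists_nonsquare (F := ZMod (pr i)) (by rwa [ZMod.ringChar_zmod_n])
    obtain ⟨n, hn4, hnp⟩ := Nat.chineseRemainder hc4 1 a.val
    have h4 : n % 4 = 1 := hn4.of_dvd ⟨M, rfl⟩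
    have hodd : Odd n := by rw [Nat.odd_iff]; omega
    have hna : ((n : ℤ) : ZMod (pr i)) = a := by
      have := (ZMod.natCast_eq_natCast_iff _ _ _).2 hnp
      rw [ZMod.natCast_zmod_val] at this
      rw [Int.cast_natCast, this]
    have hJ : jacobiSym n (pr i) = -1 := by
      refine (ZMod.nonsquare_iff_jacobiSym_eq_neg_one (a := (n:ℤ)) (p := pr i)).2 ?_; rw [hna]; exact ha
    refine ⟨n, ?_, ?_, ?_⟩
    · rw [hq, show 4 * (pr i * M) = (4 * M) * pr i by ring]
      refine Nat.Coprime.mul_right ?_ ?_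
      · rw [Nat.Coprime, hn4.gcd_eq]; simp
      · have : jacobiSym n (pr i) ≠ 0 := by rw [hJ]; norm_num
        by_contra hcon
        apply this
        rw [jacobiSym.eq_zero_iff]
        exact ⟨(pr_prime i).ne_zero, by simpa [Int.gcd_natCast_natCast] using hcon⟩
    · rw [← jacobiSym.quadratic_reciprocity_one_mod_four h4 hodd', hJ]
    · intro j hj hji
      rw [jac_congr (n := 1) hodd odd_one, jacobiSym.one_right]
      exact hn4.of_dvd (Nat.mul_dvd_mul_left 4 (hdvd j hj hji))

lemma jvec_surjective (k : ℕ) : Function.Surjective (jvec k) := by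
  rw [← MonoidHom.range_eq_top, eq_top_iff]
  intro ε _
  rw [← Finset.univ_prod_mulSingle ε]
  refine Subgroup.prod_mem _ fun i _ => ?_
  rcases Int.units_eq_one_or (ε i) with h | h
  · rw [h, Pi.mulSingle_one]; exact Subgroup.one_mem _
  · obtain ⟨n, hc, h1, h2⟩ := exists_sign k i i.2
    refine ⟨ZMod.unitOfCoprime n hc, ?_⟩
    funext j
    rw [Units.ext_iff, jvec_cast k _ j n (by simp)]
    by_cases hj : j = i
    · subst hj
      rw [h1, h]; simp
    · rw [h2 j j.2 (fun h => hj (Fin.ext h)), Pi.mulSingle_eq_of_ne hj]; simp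

open Classical in
lemma jvec_count (k : ℕ) (ε : Fin k → ℤˣ) :
    (Finset.univ.filter (fun u => jvec k u = ε)).card * 2 ^ k = (qm k).totient := by
  have h1 : ∀ η : Fin k → ℤˣ, (Finset.univ.filter (fun u => jvec k u = η)).card = (Finset.univ.filter (fun u => jvec k u = ε)).card := by
    intro η
    exact MonoidHom.card_fiber_eq_of_mem_range _ (jvec_surjective k η) (jvec_surjective k ε)
  have h2 := Finset.card_eq_sum_card_fiberwise (f := jvec k) (s := Finset.univ) (t := Finset.univ) (by intro x _; simp)
  rw [Finset.sum_congr rfl (fun η _ => h1 η), Finset.sum_const, Finset.card_univ, Finset.card_univ, ZMod.card_units_eq_totient, Fintype.card_fun, Fintype.card_fin] at h2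
  rw [h2, smul_eq_mul, mul_comm]
  simp

end Erd

namespace Erd

noncomputable abbrev np (p : ℕ) : ℕ := leastQuadraticNonresidue p

lemma nonsq_iff {p : ℕ} (hp : p.Prime) (n : ℕ) : jacobiSym n p = -1 ↔ ¬ IsSquare (n : ZMod p) := by
  have : Fact p.Prime := ⟨hp⟩
  have := ZMod.nonsquare_iff_jacobiSym_eq_neg_one (a := n) (p := p)
  rw [this, Int.cast_natCast]

lemma jac_one_of_sq {p : ℕ} (hp : p.Prime) {n : ℕ} (h0 : 0 < n) (hn : n < p) (hs : IsSquare (n : ZMod p)) : jacobiSym n p = 1 := by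
  have hne : jacobiSym n p ≠ -1 := fun h => (nonsq_iff hp n).1 h hs
  have hcop : Int.gcd n p = 1 := by
    rw [Int.gcd_natCast_natCast]
    exact Nat.Coprime.symm (hp.coprime_iff_not_dvd.2 (Nat.not_dvd_of_pos_of_lt h0 hn))
  exact (jacobiSym.eq_one_or_neg_one hcop).resolve_right hne

lemma np_spec {p : ℕ} (hp : p.Prime) (h2 : 2 < p) : 0 < np p ∧ np p < p ∧ ¬ IsSquare (np p : ZMod p) := by
  have hf : Fact p.Prime := ⟨hp⟩
  obtain ⟨a, ha⟩ := FiniteField.exists_nonsquare (F := ZMod p) (by rw [ZMod.ringChar_zmod_n]; omega)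
  have hmem : a.val ∈ {n : ℕ | 0 < n ∧ ¬ IsSquare (n : ZMod p)} := by
    refine ⟨?_, by rw [ZMod.natCast_zmod_val]; exact ha⟩
    rw [Nat.pos_iff_ne_zero]
    intro h
    rw [ZMod.val_eq_zero] at h
    exact ha (h ▸ IsSquare.zero)
  have := Nat.sInf_mem ⟨_, hmem⟩
  exact ⟨this.1, lt_of_le_of_lt (Nat.sInf_le hmem) (ZMod.val_lt a), this.2⟩

lemma sq_of_lt {p m : ℕ} (h0 : 0 < m) (hm : m < np p) : IsSquare (m : ZMod p) := by
  by_contra h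
  have : np p ≤ m := Nat.sInf_le ⟨h0, h⟩
  omega

lemma np_le {p m : ℕ} (h0 : 0 < m) (hm : ¬ IsSquare (m : ZMod p)) : np p ≤ m := Nat.sInf_le ⟨h0, hm⟩

lemma np_prime {p : ℕ} (hp : p.Prime) (h2 : 2 < p) : (np p).Prime := by
  obtain ⟨h0, hlt, hns⟩ := np_spec hp h2
  by_contra hcon
  have h1 : np p ≠ 1 := by
    intro h; rw [h] at hns; simp at hns
  obtain ⟨a, b, ha, hb, hab⟩ := (Nat.not_prime_iff_exists_mul_eq (by omega)).1 hcon
  have h3 : 0 < a := by rcases Nat.eq_zero_or_pos a with h | h; · simp [h] at hab; omega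
                        · exact h
  have h4 : 0 < b := by rcases Nat.eq_zero_or_pos b with h | h; · simp [h] at hab; omega
                        · exact h
  apply hns
  rw [← hab]
  push_cast
  exact (sq_of_lt h3 ha).mul (sq_of_lt h4 hb)

lemma np_ge_iff {p : ℕ} (hp : p.Prime) (h2 : 2 < p) {k : ℕ} (h : pr k ≤ np p) {i : ℕ} (hi : i < k) :
    jacobiSym (pr i) p = 1 := by
  have := pr_strictMono hi
  have h3 := np_spec hp h2
  exact jac_one_of_sq hp (pr_prime i).pos (by omega) (sq_of_lt (pr_prime i).pos (by omega))

lemma np_eq {p : ℕ} (hp : p.Prime) (h2 : 2 < p) {k : ℕ} (h : np p = pr k) : jacobiSym (pr k) p = -1 := by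
  rw [nonsq_iff hp, ← h]; exact (np_spec hp h2).2.2

lemma np_eq_of {p : ℕ} (hp : p.Prime) (h2 : 2 < p) {k : ℕ} (h1 : ∀ i < k, jacobiSym (pr i) p = 1)
    (hk : jacobiSym (pr k) p = -1) : np p = pr k := by
  obtain ⟨j, hj⟩ := exists_pr (np_prime hp h2)
  have h3 := np_eq hp h2 hj.symm
  have h4 : np p ≤ pr k := np_le (pr_prime k).pos ((nonsq_iff hp _).1 hk)
  have h5 : k ≤ j := by
    by_contra hcon
    rw [h1 j (by omega)] at h3
    norm_num at h3
  have := pr_strictMono.monotone h5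
  omega

lemma coprime_qm {p : ℕ} (hp : p.Prime) (h2 : 2 < p) {k : ℕ} (h : ∀ i < k, pr i < p) : p.Coprime (qm k) := by
  unfold qm
  refine Nat.Coprime.mul_right ?_ (Nat.Coprime.prod_right fun i hi => ?_)
  · exact Nat.Coprime.pow_right 2 (Nat.coprime_two_right.2 (hp.odd_of_ne_two (by omega)))
  · exact (Nat.coprime_primes hp (pr_prime i)).2 (h i (Finset.mem_range.1 hi)).ne'

open Classical in
lemma fiber_ge {p : ℕ} (hp : p.Prime) (h2 : 2 < p) {k : ℕ} (h : pr k ≤ np p) :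
    ∃ u ∈ Finset.univ.filter (fun u => jvec k u = 1), (p : ZMod (qm k)) = (u : (ZMod (qm k))ˣ) := by
  have h3 := np_spec hp h2
  have hc : p.Coprime (qm k) := coprime_qm hp h2 fun i hi => by have := pr_strictMono hi; omega
  refine ⟨ZMod.unitOfCoprime p hc, ?_, by simp⟩
  simp only [Finset.mem_filter, Finset.mem_univ, true_and]
  funext i
  rw [Units.ext_iff, jvec_cast k _ i p (by simp), np_ge_iff hp h2 h i.2]; simp

/-- the sign pattern for `np p = pr k` -/
def pat (k : ℕ) : Fin (k + 1) → ℤˣ := fun i => if (i : ℕ) < k then 1 else -1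

open Classical in
lemma fiber_eq {p : ℕ} (hp : p.Prime) (k : ℕ) :
    (2 < p ∧ np p = pr k) ↔
    ∃ u ∈ Finset.univ.filter (fun u => jvec (k + 1) u = pat k), (p : ZMod (qm (k + 1))) = (u : (ZMod (qm (k+1)))ˣ) := by
  constructor
  · rintro ⟨h2, h⟩
    have h3 := np_spec hp h2
    have hc : p.Coprime (qm (k+1)) := coprime_qm hp h2 fun i hi => by
      have := pr_strictMono.monotone (Nat.lt_succ_iff.1 hi); omega
    refine ⟨ZMod.unitOfCoprime p hc, ?_, by simp⟩
    simp only [Finset.mem_filter, Finset.mem_univ, true_and]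
    funext i
    rw [Units.ext_iff, jvec_cast (k+1) _ i p (by simp), pat]
    by_cases hi : (i : ℕ) < k
    · rw [np_ge_iff hp h2 h.ge hi]; simp [hi]
    · have : (i : ℕ) = k := by omega
      rw [this, np_eq hp h2 h]; simp
  · rintro ⟨u, hu, hpu⟩
    simp only [Finset.mem_filter, Finset.mem_univ, true_and] at hu
    have hj : ∀ i : Fin (k+1), ((pat k i : ℤˣ) : ℤ) = jacobiSym (pr i) p := by
      intro i
      rw [← hu, jvec_cast (k+1) u i p hpu]
    have h2 : 2 < p := by
      by_contra hcon
      have : p = 2 := by have := hp.two_le; omega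
      have hcu : p.Coprime (qm (k+1)) := by
        rw [← ZMod.isUnit_iff_coprime, hpu]; exact u.isUnit
      have := Nat.Coprime.coprime_dvd_right (two_dvd_qm _) hcu
      subst p; simp at this
    refine ⟨h2, np_eq_of hp h2 ?_ ?_⟩
    · intro i hi
      have := hj ⟨i, by omega⟩
      rw [← this]; simp [pat, hi]
    · have := hj ⟨k, by omega⟩
      rw [← this]; simp [pat]

lemma density_np (k : ℕ) : Tendsto (fun n : ℕ => (((Nat.primesLE n).filter (fun p : ℕ => 2 < p ∧ np p = pr k)).card : ℝ) / Nat.primeCounting n)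
      atTop (𝓝 (1 / 2 ^ (k + 1))) := by
  classical
  have h := prime_density (qm (k+1)) (Finset.univ.filter (fun u => jvec (k + 1) u = pat k))
  have hc := jvec_count (k + 1) (pat k)
  have hval : (((Finset.univ.filter (fun u => jvec (k + 1) u = pat k)).card : ℝ) / (qm (k+1)).totient) = 1 / 2 ^ (k+1) := by
    rw [← hc]
    have : (Finset.univ.filter (fun u => jvec (k + 1) u = pat k)).card ≠ 0 := by
      intro h0
      rw [h0, zero_mul] at hc
      have := Nat.totient_pos.2 (qm_pos (k+1))
      omega
    have : ((Finset.univ.filter (fun u => jvec (k + 1) u = pat k)).card : ℝ) ≠ 0 := by exact_mod_cast this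
    push_cast
    field_simp
  rw [hval] at h
  refine h.congr fun n => ?_
  congr 3
  refine Finset.filter_congr fun p hp => ?_
  rw [fiber_eq (Nat.prime_of_mem_primesLE hp)]

end Erd

namespace Erd

lemma fact_dvd (q a M : ℕ) (hq : 0 < q) (ha : 0 < a) : M.factorial ∣ q ^ M * ∏ m ∈ Finset.range M, (a + q * m) := by
  have hA : ∏ m ∈ Finset.range M, (a + q * m) ≠ 0 := Finset.prod_ne_zero_iff.2 fun m _ => by omega
  have hne : q ^ M * ∏ m ∈ Finset.range M, (a + q * m) ≠ 0 := mul_ne_zero (pow_ne_zero _ hq.ne') hA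
  rw [← Nat.factorization_prime_le_iff_dvd (Nat.factorial_ne_zero M) hne]
  intro l hl
  have hf : Fact l.Prime := ⟨hl⟩
  rw [← hl.pow_dvd_iff_le_factorization hne]
  by_cases hlq : l ∣ q
  · refine Dvd.dvd.mul_right ?_ _
    refine dvd_trans (pow_dvd_pow l ?_) (pow_dvd_pow_of_dvd hlq M)
    rw [Nat.factorization_def _ hl]
    have := sub_one_mul_padicValNat_factorial (p := l) M
    have h2 := hl.two_le
    calc padicValNat l M.factorial = 1 * padicValNat l M.factorial := (one_mul _).symm
      _ ≤ (l - 1) * padicValNat l M.factorial := Nat.mul_le_mul_right _ (by omega)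
      _ = _ := this
      _ ≤ M := Nat.sub_le _ _
  · refine Dvd.dvd.mul_left ?_ _
    set F := l ^ (M.factorial.factorization l) with hF
    have hFd : F ∣ M.factorial := Nat.ordProj_dvd _ _
    have hco : q.Coprime F := Nat.Coprime.pow_right _ ((Nat.Prime.coprime_iff_not_dvd hl).2 hlq).symm
    have hu : IsUnit (q : ZMod F) := (ZMod.isUnit_iff_coprime q F).2 hco
    obtain ⟨u, hu⟩ := hu
    have hF0 : F ≠ 0 := pow_ne_zero _ hl.ne_zero
    have : NeZero F := ⟨hF0⟩
    set b := ((a : ZMod F) * (u⁻¹ : (ZMod F)ˣ)).val with hb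
    have hbc : (b : ZMod F) = (a : ZMod F) * (u⁻¹ : (ZMod F)ˣ) := by rw [hb, ZMod.natCast_zmod_val]
    have h1 : F ∣ ∏ m ∈ Finset.range M, (b + m) := by
      rw [← Nat.ascFactorial_eq_prod_range]
      exact hFd.trans (Nat.factorial_dvd_ascFactorial _ _)
    rw [← ZMod.natCast_eq_zero_iff] at h1 ⊢
    have h2 : ((∏ m ∈ Finset.range M, (a + q * m) : ℕ) : ZMod F) = (q : ZMod F) ^ M * ((∏ m ∈ Finset.range M, (b + m) : ℕ) : ZMod F) := by
      push_cast
      have : (q : ZMod F) ^ M = ∏ m ∈ Finset.range M, (q : ZMod F) := by simp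
      rw [this, ← Finset.prod_mul_distrib]
      refine Finset.prod_congr rfl fun m _ => ?_
      rw [hbc, mul_add, mul_comm (a : ZMod F), ← mul_assoc, ← hu, Units.mul_inv, one_mul]
    rw [h2, h1, mul_zero]

lemma class_bound (q a M : ℕ) (hq : 0 < q) (ha : 0 < a) (haq : a < q) (hM : 1 < M)  :
    (((Finset.range (q * M)).filter (fun p : ℕ => p.Prime ∧ M < p ∧ p % q = a)).card : ℝ) * Real.log M
      ≤ M * (1 + 2 * Real.log q) := by
  set T := (Finset.range (q * M)).filter (fun p : ℕ => p.Prime ∧ M < p ∧ p % q = a) with hT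
  set A := ∏ m ∈ Finset.range M, (a + q * m) with hA
  have hmem : ∀ p ∈ T, p < q * M ∧ p.Prime ∧ M < p ∧ p % q = a := by
    intro p hp
    simpa [hT] using hp
  have h1 : (∏ p ∈ T, p) ∣ A := by
    refine Finset.prod_primes_dvd _ (fun p hp => (hmem p hp).2.1.prime) fun p hp => ?_
    obtain ⟨h1, h2, h3, h4⟩ := hmem p hp
    have h5 : p / q < M := Nat.div_lt_of_lt_mul h1
    have h6 : p = a + q * (p / q) := by rw [← h4]; exact (Nat.mod_add_div p q).symm
    conv_lhs => rw [h6]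
    exact Finset.dvd_prod_of_mem (fun m => a + q * m) (Finset.mem_range.2 h5)
  have h2 : (∏ p ∈ T, p).Coprime M.factorial := by
    refine Nat.Coprime.prod_left fun p hp => ?_
    obtain ⟨h1, h2, h3, h4⟩ := hmem p hp
    rw [h2.coprime_iff_not_dvd, h2.dvd_factorial]; omega
  have h3 : (∏ p ∈ T, p) * M.factorial ∣ q ^ M * A :=
    Nat.Coprime.mul_dvd_of_dvd_of_dvd h2 (h1.mul_left _) (fact_dvd q a M hq ha)
  have hA0 : 0 < A := Finset.prod_pos fun m _ => by omega
  have h4 := Nat.le_of_dvd (by positivity) h3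
  have h5 : M ^ T.card ≤ ∏ p ∈ T, p := Finset.pow_card_le_prod _ _ _ fun p hp => (hmem p hp).2.2.1.le
  have h6 : A ≤ (q * M) ^ M := by
    refine (Finset.prod_le_pow_card _ _ (q * M) fun m hm => ?_).trans (by simp)
    have hm := Finset.mem_range.1 hm
    calc a + q * m ≤ q + q * m := by omega
      _ = q * (m + 1) := by ring
      _ ≤ q * M := Nat.mul_le_mul_left _ hm
  have h7 : M ^ T.card * M.factorial ≤ q ^ M * (q * M) ^ M :=
    (Nat.mul_le_mul_right _ h5).trans (h4.trans (Nat.mul_le_mul_left _ h6))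
  have h8 : (M : ℝ) ^ T.card * M.factorial ≤ q ^ M * (q * M) ^ M := by exact_mod_cast h7
  have h9 := Real.pow_div_factorial_le_exp (x := (M:ℝ)) (by positivity) M
  have hfac : (0:ℝ) < M.factorial := by exact_mod_cast M.factorial_pos
  have hMr : (1:ℝ) < M := by exact_mod_cast hM
  have hqr : (0:ℝ) < q := by exact_mod_cast hq
  have h10 : (M : ℝ) ^ T.card ≤ q ^ M * q ^ M * Real.exp M := by
    rw [div_le_iff₀ hfac] at h9
    have : (M : ℝ) ^ T.card * M.factorial ≤ (q ^ M * q ^ M * Real.exp M) * M.factorial := by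
      refine h8.trans ?_
      rw [mul_pow]
      calc (q:ℝ) ^ M * (q ^ M * M ^ M) = (q ^ M * q ^ M) * M ^ M := by ring
        _ ≤ (q ^ M * q ^ M) * (Real.exp M * M.factorial) := by gcongr
        _ = _ := by ring
    exact le_of_mul_le_mul_right this hfac
  have h11 := Real.log_le_log (by positivity) h10
  rw [Real.log_pow, Real.log_mul (by positivity) (by positivity), Real.log_mul (by positivity) (by positivity), Real.log_pow, Real.log_exp] at h11
  linarith

end Erd

namespace Erd

lemma log_le_two_sqrt {x : ℝ} (hx : 0 < x) : Real.log x ≤ 2 * Real.sqrt x := by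
  have h := Real.log_le_sub_one_of_pos (Real.sqrt_pos.2 hx)
  rw [Real.log_sqrt hx.le] at h
  linarith

lemma pr_le (k : ℕ) : (pr k : ℝ) ≤ 9 * (k + 3) ^ 2 := by
  set n := pr k with hn
  have h2 : 2 ≤ n := (pr_prime k).two_le
  have h2' : (2:ℝ) ≤ n := by exact_mod_cast h2
  have hl : 0 < Real.log n := Real.log_pos (by linarith)
  have hpi : Nat.primeCounting n = k + 1 := by
    have := Nat.primeCounting'_nth_eq k
    rw [Nat.primeCounting, Nat.primeCounting'] at *
    rw [Nat.count_succ, if_pos (pr_prime k)]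
    rw [hn, pr, this]
  have h := Chebyshev.pi_ge n
  rw [hpi, div_le_iff₀ hl] at h
  push_cast at h
  have h3 : Real.log (n + 1) ≤ 2 * Real.log n := by
    rw [← Real.log_rpow (by linarith)]
    apply Real.log_le_log (by linarith)
    norm_num
    nlinarith
  have h4 := log_le_two_sqrt (x := n) (by linarith)
  have h5 := Real.log_two_gt_d9
  have h6 := Real.mul_self_sqrt (show (0:ℝ) ≤ n by linarith)
  set s := Real.sqrt n with hs
  have hs0 : 0 < s := Real.sqrt_pos.2 (by linarith)
  have hk : (0:ℝ) ≤ k := by positivity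
  have h7 : (n : ℝ) * Real.log 2 ≤ (k + 3) * (2 * s) := by
    have : (k + 3 : ℝ) * Real.log n ≤ (k + 3) * (2 * s) := by gcongr
    linarith
  have h8 : s ≤ 3 * (k + 3) := by
    have h9 : s * s * 0.69 ≤ (k + 3) * (2 * s) := by
      rw [h6]
      have : (n:ℝ) * 0.69 ≤ n * Real.log 2 := by gcongr; linarith
      linarith
    have : s * (s * 0.69) ≤ s * (2 * (k + 3)) := by linarith
    have := le_of_mul_le_mul_left this hs0
    linarith
  rw [← h6]
  nlinarith

lemma qm_le (k : ℕ) : qm k ≤ 4 ^ (pr k + 1) := by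
  have h1 : (∏ i ∈ Finset.range k, pr i) ∣ primorial (pr k) := by
    have : (∏ i ∈ Finset.range k, pr i) = ∏ p ∈ (Finset.range k).image pr, p := by
      rw [Finset.prod_image]; exact fun a _ b _ h => pr_strictMono.injective h
    rw [this, primorial]
    refine Finset.prod_dvd_prod_of_subset _ _ _ fun p hp => ?_
    obtain ⟨i, hi, rfl⟩ := Finset.mem_image.1 hp
    have := pr_strictMono (Finset.mem_range.1 hi)
    simp only [Finset.mem_filter, Finset.mem_range]
    exact ⟨by omega, pr_prime i⟩
  have h2 := (Nat.le_of_dvd (primorial_pos _) h1).trans (primorial_le_four_pow _)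
  unfold qm
  rw [pow_succ]; omega

lemma pi_upper {M : ℕ} (hM : 1 < M) : (Nat.primeCounting M : ℝ) * Real.log M ≤ 5 * M := by
  have hM' : (1:ℝ) < M := by exact_mod_cast hM
  have h := Chebyshev.pi_le_log4_mul_div hM'
  have hl : 0 < Real.log M := Real.log_pos hM'
  rw [Nat.floor_natCast, Real.log_sqrt (by linarith)] at h
  have h4 := log_le_two_sqrt (x := M) (by linarith)
  have h6 := Real.mul_self_sqrt (show (0:ℝ) ≤ M by linarith)
  have h5 : Real.log 4 ≤ 1.4 := by
    have : (4:ℝ) = 2 ^ 2 := by norm_num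
    rw [this, Real.log_pow]
    have := Real.log_two_lt_d9
    push_cast; linarith
  calc (Nat.primeCounting M : ℝ) * Real.log M ≤ (Real.log 4 * M / (Real.log M / 2) + Real.sqrt M) * Real.log M := by gcongr
    _ = 2 * Real.log 4 * M + Real.sqrt M * Real.log M := by field_simp
    _ ≤ 2 * 1.4 * M + Real.sqrt M * (2 * Real.sqrt M) := by gcongr
    _ ≤ 5 * M := by nlinarith

/-- primes with `np p ≥ pr k` -/
noncomputable def big (x k : ℕ) : Finset ℕ := (Nat.primesLE x).filter (fun p : ℕ => 2 < p ∧ pr k ≤ np p)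

lemma big_bound (x k : ℕ) (hx : qm k ^ 2 ≤ x) :
    ((big x k).card : ℝ) * Real.log x ≤ 32 * pr k * x / 2 ^ k := by
  classical
  set q := qm k with hq
  have hq0 : 0 < q := qm_pos k
  have hq4 : 4 ≤ q := by
    have : 4 ∣ q := ⟨_, rfl⟩
    exact Nat.le_of_dvd hq0 this
  set M := x / q + 1 with hM
  have hMx : x < q * M := by
    rw [hM, mul_add, mul_one]; exact Nat.lt_mul_div_succ x hq0
  have hxq : q ≤ x / q := by rw [Nat.le_div_iff_mul_le hq0]; nlinarith
  have hM1 : 1 < M := by omega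
  have hqM : q * M ≤ 2 * x := by
    rw [hM, mul_add, mul_one]
    have := Nat.mul_div_le x q
    nlinarith
  have hMM : x ≤ M * M := by nlinarith
  set S := Finset.univ.filter (fun u => jvec k u = 1) with hS
  have hcount : S.card * 2 ^ k = q.totient := jvec_count k 1
  set T : (ZMod q)ˣ → Finset ℕ := fun u => (Finset.range (q * M)).filter (fun p : ℕ => p.Prime ∧ M < p ∧ p % q = (u : ZMod q).val) with hT
  have hsub : big x k ⊆ S.biUnion fun u => (Nat.primesLE M) ∪ T u := by
    intro p hp
    rw [big, Finset.mem_filter] at hp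
    obtain ⟨hpx, h2, hk⟩ := hp
    obtain ⟨hpx, hpp⟩ := Nat.mem_primesLE.1 hpx
    obtain ⟨u, hu, hpu⟩ := fiber_ge hpp h2 hk
    refine Finset.mem_biUnion.2 ⟨u, hu, ?_⟩
    rw [Finset.mem_union]
    by_cases hpM : p ≤ M
    · exact Or.inl (Nat.mem_primesLE.2 ⟨hpM, hpp⟩)
    · right
      simp only [hT, Finset.mem_filter, Finset.mem_range]
      refine ⟨by omega, hpp, by omega, ?_⟩
      rw [← hpu, ZMod.val_natCast]
  have hMr : (1:ℝ) < M := by exact_mod_cast hM1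
  have hlM : 0 < Real.log M := Real.log_pos hMr
  have hxr : (0:ℝ) < x := by
    have : 0 < x := by nlinarith
    exact_mod_cast this
  have hc1 : ((big x k).card : ℝ) * Real.log M ≤ S.card * (M * (6 + 2 * Real.log q)) := by
    have h1 : (big x k).card ≤ ∑ u ∈ S, ((Nat.primesLE M).card + (T u).card) :=
      (Finset.card_le_card hsub).trans (Finset.card_biUnion_le.trans (Finset.sum_le_sum fun u _ => Finset.card_union_le _ _))
    have h2 : ((big x k).card : ℝ) ≤ ∑ u ∈ S, ((Nat.primeCounting M : ℝ) + (T u).card) := by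
      rw [Nat.primesLE_card_eq_primeCounting] at h1
      exact_mod_cast h1
    calc ((big x k).card : ℝ) * Real.log M ≤ (∑ u ∈ S, ((Nat.primeCounting M : ℝ) + (T u).card)) * Real.log M := by gcongr
      _ = ∑ u ∈ S, ((Nat.primeCounting M : ℝ) * Real.log M + (T u).card * Real.log M) := by
        rw [Finset.sum_mul]; exact Finset.sum_congr rfl fun u _ => by ring
      _ ≤ ∑ u ∈ S, (M * (6 + 2 * Real.log q)) := by
        refine Finset.sum_le_sum fun u _ => ?_
        have hodd := unit_odd (two_dvd_qm k) u
        have := class_bound q (u : ZMod q).val M hq0 hodd.pos (ZMod.val_lt _) hM1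
        have h5 := pi_upper hM1
        simp only [hT]
        linarith
      _ = _ := by rw [Finset.sum_const, nsmul_eq_mul]
  have hlx : Real.log x ≤ 2 * Real.log M := by
    have : (x:ℝ) ≤ M ^ 2 := by rw [sq]; exact_mod_cast hMM
    have := Real.log_le_log hxr this
    rw [Real.log_pow] at this
    exact_mod_cast this
  have hlq : Real.log q ≤ (pr k + 1) * 1.4 := by
    have : (q:ℝ) ≤ 4 ^ (pr k + 1) := by exact_mod_cast qm_le k
    have h := Real.log_le_log (by exact_mod_cast hq0) this
    rw [Real.log_pow] at h
    have h5 : Real.log 4 ≤ 1.4 := by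
      have : (4:ℝ) = 2 ^ 2 := by norm_num
      rw [this, Real.log_pow]
      have := Real.log_two_lt_d9
      push_cast; linarith
    refine h.trans ?_
    push_cast
    gcongr
  have hpr : (2:ℝ) ≤ pr k := by exact_mod_cast (pr_prime k).two_le
  have hSq : (S.card : ℝ) * M * 2 ^ k ≤ 2 * x := by
    have h1 : S.card * M * 2 ^ k ≤ 2 * x := by
      calc S.card * M * 2 ^ k = (S.card * 2 ^ k) * M := by ring
        _ = q.totient * M := by rw [hcount]
        _ ≤ q * M := Nat.mul_le_mul_right _ (Nat.totient_le q)
        _ ≤ _ := hqM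
    exact_mod_cast h1
  rw [le_div_iff₀ (by positivity)]
  calc ((big x k).card : ℝ) * Real.log x * 2 ^ k ≤ ((big x k).card : ℝ) * (2 * Real.log M) * 2 ^ k := by gcongr
    _ = 2 * (((big x k).card : ℝ) * Real.log M) * 2 ^ k := by ring
    _ ≤ 2 * (S.card * (M * (6 + 2 * Real.log q))) * 2 ^ k := by gcongr
    _ = 2 * (S.card * M * 2 ^ k) * (6 + 2 * Real.log q) := by ring
    _ ≤ 2 * (S.card * M * 2 ^ k) * (8 * pr k) := by gcongr; linarith
    _ ≤ 2 * (2 * x) * (8 * pr k) := by gcongr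
    _ = _ := by ring

end Erd

namespace Erd

lemma periodic_sum (f : ℕ → ℤ) (m : ℕ) (hm : 0 < m) (hper : ∀ n, f (n + m) = f n) (hb : ∀ n, |f n| ≤ 1)
    (h0 : ∑ n ∈ Finset.range m, f n = 0) (N : ℕ) : |∑ n ∈ Finset.range N, f n| ≤ m := by
  induction N using Nat.strong_induction_on with
  | _ N ih =>
    by_cases hN : N ≤ m
    · calc |∑ n ∈ Finset.range N, f n| ≤ ∑ n ∈ Finset.range N, |f n| := Finset.abs_sum_le_sum_abs _ _
        _ ≤ ∑ n ∈ Finset.range N, 1 := Finset.sum_le_sum fun n _ => hb n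
        _ = N := by simp
        _ ≤ m := by exact_mod_cast hN
    · have h1 := ih (N - m) (by omega)
      have h2 : N = m + (N - m) := by omega
      rw [h2, Finset.sum_range_add, h0, zero_add]
      have : ∑ i ∈ Finset.range (N - m), f (m + i) = ∑ i ∈ Finset.range (N - m), f i :=
        Finset.sum_congr rfl fun i _ => by rw [add_comm, hper]
      rw [this]; exact h1

lemma jac_sum (p : ℕ) (hp : p.Prime) (h2 : 2 < p) : ∑ n ∈ Finset.range p, jacobiSym n p = 0 := by
  have hf : Fact p.Prime := ⟨hp⟩
  have h := quadraticChar_sum_zero (F := ZMod p) (by rw [ZMod.ringChar_zmod_n]; omega)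
  rw [← h]
  refine Finset.sum_nbij (fun n : ℕ => (n : ZMod p)) (by simp) ?_ ?_ ?_
  · intro a ha b hb hab
    simp only [Finset.coe_range, Set.mem_Iio] at ha hb
    have := (ZMod.natCast_eq_natCast_iff' a b p).1 hab
    rwa [Nat.mod_eq_of_lt ha, Nat.mod_eq_of_lt hb] at this
  · intro z _
    exact ⟨z.val, by simpa using ZMod.val_lt z, by simp⟩
  · intro n _
    rw [← jacobiSym.legendreSym.to_jacobiSym, legendreSym, Int.cast_natCast]

lemma jac_mod (n p : ℕ) : jacobiSym ((n % p : ℕ)) p = jacobiSym n p := by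
  rw [jacobiSym.mod_left n p]; norm_cast

lemma jac_abs (a : ℤ) (p : ℕ) : |jacobiSym a p| ≤ 1 := by
  rcases jacobiSym.trichotomy a p with h | h | h <;> rw [h] <;> norm_num

lemma jac_pair (p r : ℕ) (hp : p.Prime) (hr : r.Prime) (hp2 : 2 < p) (hpr : p ≠ r) (N : ℕ) :
    |∑ n ∈ Finset.range N, jacobiSym n p * jacobiSym n r| ≤ p * r := by
  have hpos : 0 < p * r := Nat.mul_pos hp.pos hr.pos
  have := periodic_sum (fun n => jacobiSym n p * jacobiSym n r) (p * r) hpos ?_ ?_ ?_ N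
  · exact_mod_cast this
  · intro n
    rw [← jac_mod (n + p * r) p, ← jac_mod (n + p * r) r, Nat.add_mul_mod_self_left, Nat.add_mul_mod_self_right, jac_mod, jac_mod]
  · intro n
    rw [abs_mul]
    exact mul_le_one₀ (jac_abs _ _) (abs_nonneg _) (jac_abs _ _)
  · have hcop : p.Coprime r := (Nat.coprime_primes hp hr).2 hpr
    have hinj : Set.InjOn (fun n : ℕ => (n % p, n % r)) (Finset.range (p * r)) := by
      intro a ha b hb hab
      simp only [Finset.coe_range, Set.mem_Iio] at ha hb
      simp only [Prod.mk.injEq] at hab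
      have h : a ≡ b [MOD p * r] := (Nat.modEq_and_modEq_iff_modEq_mul hcop).1 ⟨hab.1, hab.2⟩
      exact h.eq_of_lt_of_lt ha hb
    have hmaps : ∀ n ∈ Finset.range (p * r), (n % p, n % r) ∈ Finset.range p ×ˢ Finset.range r := by
      intro n _
      simp [Nat.mod_lt _ hp.pos, Nat.mod_lt _ hr.pos]
    have h := Finset.sum_nbij (s := Finset.range (p * r)) (t := Finset.range p ×ˢ Finset.range r)
      (f := fun n : ℕ => jacobiSym n p * jacobiSym n r) (g := fun z : ℕ × ℕ => jacobiSym z.1 p * jacobiSym z.2 r)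
      (fun n : ℕ => (n % p, n % r)) hmaps hinj
      (Finset.surjOn_of_injOn_of_card_le _ hmaps hinj (by simp))
      (fun n _ => by simp only [jac_mod])
    rw [h, Finset.sum_product]
    simp only
    rw [← Finset.sum_mul_sum, jac_sum p hp hp2, zero_mul]

lemma large_sieve (P Y : Finset ℕ) (x N : ℕ) (hP : ∀ p ∈ P, p.Prime ∧ 2 < p ∧ p ≤ x) (hY : ∀ n ∈ Y, n < N)
    (h1 : ∀ n ∈ Y, ∀ p ∈ P, jacobiSym n p = 1) :
    P.card * Y.card ≤ N + P.card * x ^ 2 := by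
  have hlow : (Y.card : ℤ) * (P.card : ℤ) ^ 2 ≤ ∑ n ∈ Finset.range N, (∑ p ∈ P, jacobiSym n p) ^ 2 := by
    calc (Y.card : ℤ) * (P.card : ℤ) ^ 2 = ∑ n ∈ Y, (∑ p ∈ P, jacobiSym n p) ^ 2 := by
          rw [← nsmul_eq_mul, ← Finset.sum_const]
          refine Finset.sum_congr rfl fun n hn => ?_
          rw [Finset.sum_congr rfl (h1 n hn)]; simp
      _ ≤ _ := Finset.sum_le_sum_of_subset_of_nonneg (fun n hn => Finset.mem_range.2 (hY n hn)) fun _ _ _ => sq_nonneg _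
  have hup : ∑ n ∈ Finset.range N, (∑ p ∈ P, jacobiSym n p) ^ 2 ≤ (P.card : ℤ) * N + (P.card : ℤ) ^ 2 * x ^ 2 := by
    calc ∑ n ∈ Finset.range N, (∑ p ∈ P, jacobiSym n p) ^ 2
        = ∑ p ∈ P, ∑ r ∈ P, ∑ n ∈ Finset.range N, jacobiSym n p * jacobiSym n r := by
          simp_rw [sq, Finset.sum_mul_sum]
          rw [Finset.sum_comm]
          refine Finset.sum_congr rfl fun p _ => ?_
          rw [Finset.sum_comm]
      _ ≤ ∑ p ∈ P, ∑ r ∈ P, ((if p = r then (N : ℤ) else 0) + x ^ 2) := by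
          refine Finset.sum_le_sum fun p hp => Finset.sum_le_sum fun r hr => ?_
          obtain ⟨hp1, hp2, hp3⟩ := hP p hp
          obtain ⟨hr1, hr2, hr3⟩ := hP r hr
          split_ifs with hpr
          · have : ∑ n ∈ Finset.range N, jacobiSym n p * jacobiSym n r ≤ ∑ n ∈ Finset.range N, 1 := by
              refine Finset.sum_le_sum fun n _ => ?_
              refine (le_abs_self _).trans ?_
              rw [abs_mul]
              exact mul_le_one₀ (jac_abs _ _) (abs_nonneg _) (jac_abs _ _)
            simp only [Finset.sum_const, Finset.card_range, nsmul_eq_mul, mul_one] at this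
            have h3 : (0:ℤ) ≤ x ^ 2 := by positivity
            linarith
          · have := (le_abs_self _).trans (jac_pair p r hp1 hr1 hp2 hpr N)
            rw [zero_add]
            refine this.trans ?_
            rw [sq]
            gcongr
      _ = _ := by
          simp [Finset.sum_add_distrib]
          ring
  have h3 := hlow.trans hup
  rcases Nat.eq_zero_or_pos P.card with h0 | h0
  · rw [h0]; simp
  · have h0' : (0:ℤ) < P.card := by exact_mod_cast h0
    have h4 : (P.card : ℤ) * (P.card * Y.card) ≤ P.card * (N + P.card * x ^ 2) := by nlinarith
    exact_mod_cast le_of_mul_le_mul_left h4 h0'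

lemma smooth_set (B u : ℕ) : ∃ Y : Finset ℕ, (∀ n ∈ Y, n < B ^ u + 1) ∧
    (Nat.primeCounting B) ^ u ≤ u.factorial * Y.card ∧
    ∀ n ∈ Y, ∀ p : ℕ, (∀ r : ℕ, r.Prime → r ≤ B → jacobiSym r p = 1) → jacobiSym n p = 1 := by
  classical
  set s := Fintype.piFinset (fun _ : Fin u => Nat.primesLE B) with hs
  have hmem : ∀ f ∈ s, ∀ i, f i ≤ B ∧ (f i).Prime := by
    intro f hf i
    exact Nat.mem_primesLE.1 (Fintype.mem_piFinset.1 hf i)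
  refine ⟨s.image fun f => ∏ i, f i, ?_, ?_, ?_⟩
  · intro n hn
    obtain ⟨f, hf, rfl⟩ := Finset.mem_image.1 hn
    have := Finset.prod_le_pow_card Finset.univ f B fun i _ => (hmem f hf i).1
    simp only [Finset.card_univ, Fintype.card_fin] at this
    exact Nat.lt_succ_of_le this
  · have hc : s.card = (Nat.primeCounting B) ^ u := by
      rw [hs, Fintype.card_piFinset_const, Nat.primesLE_card_eq_primeCounting]
      try simp
    rw [← hc]
    refine Finset.card_le_mul_card_image _ _ fun n hn => ?_
    have hperm : ∀ f ∈ s.filter (fun f => ∏ i, f i = n), (List.ofFn f).Perm n.primeFactorsList := by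
      intro f hf
      obtain ⟨hf, hfn⟩ := Finset.mem_filter.1 hf
      refine Nat.primeFactorsList_unique ?_ ?_
      · rw [List.prod_ofFn, hfn]
      · intro p hp
        obtain ⟨i, rfl⟩ := (List.mem_ofFn' _ _).1 hp
        exact (hmem f hf i).2
    obtain ⟨f0, hf0, h0⟩ := Finset.mem_image.1 hn
    have hlen : n.primeFactorsList.length = u := by
      have := (hperm f0 (Finset.mem_filter.2 ⟨hf0, h0⟩)).length_eq
      simpa using this.symm
    calc (s.filter (fun f => ∏ i, f i = n)).card ≤ (n.primeFactorsList.permutations.toFinset).card := by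
          refine Finset.card_le_card_of_injOn (fun f => List.ofFn f) ?_ ?_
          · intro f hf
            simp only [List.coe_toFinset, Set.mem_ofPred_eq, List.mem_permutations]
            exact hperm f hf
          · intro f _ g _ h
            exact List.ofFn_injective h
      _ ≤ n.primeFactorsList.permutations.length := List.toFinset_card_le _
      _ = u.factorial := by rw [List.length_permutations, hlen]
  · intro n hn p hp
    obtain ⟨f, hf, rfl⟩ := Finset.mem_image.1 hn
    push_cast
    have : ∀ t : Finset (Fin u), jacobiSym (∏ i ∈ t, (f i : ℤ)) p = 1 := by
      intro t
      induction t using Finset.induction_on with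
      | empty => simp
      | insert a t ha ih => rw [Finset.prod_insert ha, jacobiSym.mul_left, ih, hp _ (hmem f hf a).2 (hmem f hf a).1]; norm_num
    exact this _

end Erd

namespace Erd

lemma pi_half : ∀ᶠ n : ℕ in atTop, (n : ℝ) ≤ 2 * (Nat.primeCounting n * Real.log n) := by
  have h := pi_asymp.eventually (lt_mem_nhds (show (1/2 : ℝ) < 1 by norm_num))
  filter_upwards [h, eventually_gt_atTop 0] with n hn h0
  have h0' : (0:ℝ) < n := by exact_mod_cast h0
  rw [lt_div_iff₀ h0'] at hn
  linarith

lemma pi_pow : ∃ s0 : ℕ, ∀ s ≥ s0, 2 ^ (19 * s) ≤ Nat.primeCounting (2 ^ (20 * s)) := by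
  obtain ⟨n0, hn0⟩ := eventually_atTop.1 pi_half
  refine ⟨max n0 8, fun s hs => ?_⟩
  have hs1 : n0 ≤ s := (le_max_left _ _).trans hs
  have hs2 : 8 ≤ s := (le_max_right _ _).trans hs
  have h1 : n0 ≤ 2 ^ (20 * s) := by
    have : 20 * s < 2 ^ (20 * s) := Nat.lt_two_pow_self
    omega
  have h := hn0 _ h1
  push_cast at h
  rw [Real.log_pow] at h
  have hl := Real.log_two_lt_d9
  have h28 : ∀ t : ℕ, 8 ≤ t → 28 * t ≤ 2 ^ t := by
    intro t ht
    induction t, ht using Nat.le_induction with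
    | base => norm_num
    | succ t ht ih => rw [pow_succ]; omega
  have h28s : (28 * s : ℝ) ≤ 2 ^ s := by exact_mod_cast h28 s hs2
  set c : ℝ := (Nat.primeCounting (2 ^ (20 * s)) : ℝ) with hc
  have hc0 : 0 ≤ c := by positivity
  have h3 : (2:ℝ) ^ (20 * s) ≤ c * 2 ^ s := by
    refine h.trans ?_
    calc 2 * (c * (((20 * s : ℕ) : ℝ) * Real.log 2)) = c * ((40 * s) * Real.log 2) := by push_cast; ring
      _ ≤ c * ((40 * s) * 0.7) := by gcongr; linarith
      _ = c * (28 * s) := by ring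
      _ ≤ _ := by gcongr
  have h4 : (2:ℝ) ^ (20 * s) = 2 ^ (19 * s) * 2 ^ s := by rw [← pow_add]; congr 1; ring
  rw [h4] at h3
  have h5 := le_of_mul_le_mul_right h3 (by positivity)
  rw [hc] at h5
  exact_mod_cast h5

/-- the cut-off parameter -/
def sp (x : ℕ) : ℕ := Nat.log 2 (Nat.log 2 x) + 1

noncomputable def huge (x : ℕ) : Finset ℕ := (Nat.primesLE x).filter (fun p : ℕ => 2 < p ∧ 2 ^ (20 * sp x) < np p)

lemma huge_card : ∀ᶠ x : ℕ in atTop, (huge x).card ≤ 2 ^ (3 * Nat.log 2 x / 10 + 2 * sp x + 2) := by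
  obtain ⟨s0, hs0⟩ := pi_pow
  filter_upwards [eventually_ge_atTop (2 ^ (2 ^ (s0 + 3)))] with x hx
  set L := Nat.log 2 x with hL
  have hx0 : x ≠ 0 := by
    have : 0 < 2 ^ (2 ^ (s0 + 3)) := by positivity
    omega
  have hL0 : 2 ^ (s0 + 3) ≤ L := by rw [hL]; exact (Nat.le_log_iff_pow_le (by norm_num) hx0).2 hx
  have hL8 : 8 ≤ L := by
    have : 2 ^ 3 ≤ 2 ^ (s0 + 3) := Nat.pow_le_pow_right (by norm_num) (by omega)
    omega
  have hsdef : sp x = Nat.log 2 L + 1 := rfl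
  set s := sp x with hs
  have hs1 : s0 ≤ s := by
    have := (Nat.le_log_iff_pow_le (b := 2) (by norm_num) (by omega : L ≠ 0)).2 hL0
    omega
  have hLs : L < 2 ^ s := by rw [hsdef]; exact Nat.lt_pow_succ_log_self (by norm_num) L
  have hspos : 0 < s := by omega
  set u := 3 * L / (20 * s) + 1 with hu
  have hu1 : 3 * L < 20 * s * u := by
    rw [hu, mul_add, mul_one]; exact Nat.lt_mul_div_succ _ (by omega)
  have hu2 : 20 * s * u ≤ 3 * L + 20 * s := by
    rw [hu, mul_add, mul_one]
    have := Nat.mul_div_le (3 * L) (20 * s)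
    omega
  have hu3 : u ≤ L := by
    have : 3 * L / (20 * s) ≤ 3 * L / 20 := Nat.div_le_div_left (by omega) (by norm_num)
    omega
  obtain ⟨Y, hY1, hY2, hY3⟩ := smooth_set (2 ^ (20 * s)) u
  have hP : ∀ p ∈ huge x, p.Prime ∧ 2 < p ∧ p ≤ x := by
    intro p hp
    obtain ⟨h1, h2, h3⟩ := Finset.mem_filter.1 hp
    exact ⟨(Nat.mem_primesLE.1 h1).2, h2, (Nat.mem_primesLE.1 h1).1⟩
  have hls := large_sieve (huge x) Y x _ hP hY1 (by
    intro n hn p hp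
    refine hY3 n hn p fun r hr hrB => ?_
    obtain ⟨h1, h2, h3⟩ := Finset.mem_filter.1 hp
    have h4 := np_spec (hP p hp).1 h2
    rw [← hs] at h3
    exact jac_one_of_sq (hP p hp).1 hr.pos (by omega) (sq_of_lt hr.pos (by omega)))
  -- lower bound for Y
  have hY4 : 2 ^ (18 * s * u) ≤ Y.card := by
    have h1 : u.factorial ≤ 2 ^ (s * u) := by
      calc u.factorial ≤ u ^ u := Nat.factorial_le_pow u
        _ ≤ (2 ^ s) ^ u := Nat.pow_le_pow_left (by omega) u
        _ = _ := by rw [pow_mul]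
    have h2 : 2 ^ (19 * s * u) ≤ 2 ^ (s * u) * Y.card := by
      calc 2 ^ (19 * s * u) = (2 ^ (19 * s)) ^ u := by rw [pow_mul]
        _ ≤ _ := Nat.pow_le_pow_left (hs0 s hs1) u
        _ ≤ _ := hY2
        _ ≤ _ := Nat.mul_le_mul_right _ h1
    have h3 : 2 ^ (19 * s * u) = 2 ^ (s * u) * 2 ^ (18 * s * u) := by rw [← pow_add]; congr 1; ring
    rw [h3] at h2
    exact Nat.le_of_mul_le_mul_left h2 (by positivity)
  have hxL : x < 2 ^ (L + 1) := Nat.lt_pow_succ_log_self (by norm_num) x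
  have hx2 : 2 * x ^ 2 ≤ Y.card := by
    refine le_trans ?_ hY4
    calc 2 * x ^ 2 ≤ 2 * (2 ^ (L + 1)) ^ 2 := by gcongr
      _ = 2 ^ (2 * L + 3) := by rw [← pow_mul, ← pow_succ']; congr 1; ring
      _ ≤ _ := Nat.pow_le_pow_right (by norm_num) (by
        have h5 : 18 * s * u * 20 = 18 * (20 * s * u) := by ring
        omega)
  have h6 : (huge x).card * Y.card ≤ 2 * ((2 ^ (20 * s)) ^ u + 1) := by
    have : (huge x).card * (2 * x ^ 2) ≤ (huge x).card * Y.card := Nat.mul_le_mul_left _ hx2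
    nlinarith
  have h7 : (huge x).card * 2 ^ (18 * s * u) ≤ 2 ^ (2 * s * u + 2) * 2 ^ (18 * s * u) := by
    calc (huge x).card * 2 ^ (18 * s * u) ≤ (huge x).card * Y.card := Nat.mul_le_mul_left _ hY4
      _ ≤ _ := h6
      _ ≤ 2 * ((2 ^ (20 * s)) ^ u + (2 ^ (20 * s)) ^ u) := by gcongr; exact Nat.one_le_pow _ _ (by positivity)
      _ = 2 ^ 2 * (2 ^ (20 * s)) ^ u := by ring
      _ = _ := by rw [← pow_mul, ← pow_add, ← pow_add]; congr 1; ring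
  have h8 := Nat.le_of_mul_le_mul_right h7 (by positivity)
  refine h8.trans (Nat.pow_le_pow_right (by norm_num) ?_)
  have h9 : 20 * s * u = 10 * (2 * s * u) := by ring
  omega

lemma np_sq {p : ℕ} (hp : p.Prime) (h2 : 2 < p) : (np p - 1) ^ 2 < p := by
  obtain ⟨h0, hlt, hns⟩ := np_spec hp h2
  have hn2 := (np_prime hp h2).two_le
  set n := np p with hn
  set m := p / n + 1 with hm
  have hf : Fact p.Prime := ⟨hp⟩
  have hnd : ¬ n ∣ p := fun h => by
    rcases (Nat.dvd_prime hp).1 h with h | h <;> omega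
  have hmod : p % n ≠ 0 := fun h => hnd (Nat.dvd_of_mod_eq_zero h)
  have hdm := Nat.div_add_mod p n
  have hml := Nat.mod_lt p h0
  have hnm : n * m = p + (n - p % n) := by
    rw [hm, mul_add, mul_one]; omega
  have hr : IsSquare (((n - p % n : ℕ)) : ZMod p) := sq_of_lt (by omega) (by omega)
  have hm' : n ≤ m := by
    refine np_le (by rw [hm]; exact Nat.succ_pos _) fun hms => hns ?_
    have h1 : (n : ZMod p) * m = ((n - p % n : ℕ) : ZMod p) := by
      rw [← Nat.cast_mul, hnm, Nat.cast_add, ZMod.natCast_self, zero_add]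
    have hm0 : (m : ZMod p) ≠ 0 := by
      intro h
      rw [h, mul_zero] at h1
      have := (ZMod.natCast_eq_zero_iff _ _).1 h1.symm
      have := Nat.le_of_dvd (by omega) this
      omega
    have h3 : (n : ZMod p) = ((n - p % n : ℕ) : ZMod p) / m := by
      rw [← h1]; field_simp
    rw [h3]
    exact hr.div hms
  have h5 : n * (m - 1) ≤ p := by
    have : m - 1 = p / n := by omega
    rw [this]; omega
  have h6 : n * (n - 1) ≤ p := (Nat.mul_le_mul_left n (by omega)).trans h5
  have h7 : (n - 1) ^ 2 < n * (n - 1) := by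
    rw [sq]
    exact Nat.mul_lt_mul_of_pos_right (by omega) (by omega)
  omega

end Erd

namespace Erd

lemma pr_of_count {a k : ℕ} (ha : a.Prime) (h : Nat.count Nat.Prime a = k) : pr k = a := by
  rw [← h, pr]; exact Nat.nth_count ha

lemma pr_next {k a b : ℕ} (h : pr k = a) (hab : a < b) (hb : b.Prime) (hn : ∀ m, a < m → m < b → ¬ m.Prime) : pr (k + 1) = b := by
  have h1 := pr_strictMono (Nat.lt_succ_self k)
  obtain ⟨j, hj⟩ := exists_pr hb
  have h2 : k < j := by
    rw [← pr_strictMono.lt_iff_lt, h, hj]; exact hab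
  have h3 : pr (k + 1) ≤ pr j := pr_strictMono.monotone h2
  by_contra hne
  refine hn (pr (k+1)) (by rw [← h]; exact h1) ?_ (pr_prime _)
  rw [hj] at h3
  omega

lemma tail_sum (M n : ℕ) : ∑ k ∈ Finset.range n, (pr (k + M) : ℝ) / 2 ^ (k + M + 1) ≤
    9 * (((M:ℝ) + 3) ^ 2 + 2 * (M + 3) + 3) / 2 ^ M - 9 * (((n + M : ℝ) + 3) ^ 2 + 2 * (n + M + 3) + 3) / 2 ^ (n + M) := by
  induction n with
  | zero => simp
  | succ n ih =>
    rw [Finset.sum_range_succ]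
    have h := pr_le (n + M)
    have h2 : (pr (n + M) : ℝ) / 2 ^ (n + M + 1) ≤ 9 * ((n + M : ℕ) + 3) ^ 2 / 2 ^ (n + M + 1) := by gcongr
    have h3 : 9 * (((n + M : ℕ):ℝ) + 3) ^ 2 / 2 ^ (n + M + 1) = 9 * (((n + M : ℝ) + 3) ^ 2 + 2 * (n + M + 3) + 3) / 2 ^ (n + M)
      - 9 * ((((n + 1 : ℕ) + M : ℝ) + 3) ^ 2 + 2 * ((n + 1 : ℕ) + M + 3) + 3) / 2 ^ (n + 1 + M) := by
      rw [show n + 1 + M = n + M + 1 by ring, pow_succ]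
      push_cast
      field_simp
      ring
    linarith

lemma tail_sum' (M n : ℕ) : ∑ k ∈ Finset.range n, (pr (k + M) : ℝ) / 2 ^ (k + M + 1) ≤
    9 * (((M:ℝ) + 3) ^ 2 + 2 * (M + 3) + 3) / 2 ^ M := by
  refine (tail_sum M n).trans ?_
  have : (0:ℝ) ≤ 9 * (((n + M : ℝ) + 3) ^ 2 + 2 * (n + M + 3) + 3) / 2 ^ (n + M) := by positivity
  linarith

lemma summable_pr : Summable (fun k : ℕ => (pr k : ℝ) / 2 ^ (k + 1)) :=
  summable_of_sum_range_le (fun k => by positivity) (fun n => tail_sum' 0 n)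

lemma partial_sum : ∑ k ∈ Finset.range 32, (pr k : ℝ) / 2 ^ (k + 1) = 15782475517 / 4294967296 := by
  have h0 : pr 0 = 2 := pr_of_count (by norm_num) (by decide +kernel)
  have h1 : pr 1 = 3 := pr_of_count (by norm_num) (by decide +kernel)
  have h2 : pr 2 = 5 := pr_of_count (by norm_num) (by decide +kernel)
  have h3 : pr 3 = 7 := pr_of_count (by norm_num) (by decide +kernel)
  have h4 : pr 4 = 11 := pr_of_count (by norm_num) (by decide +kernel)
  have h5 : pr 5 = 13 := pr_of_count (by norm_num) (by decide +kernel)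
  have h6 : pr 6 = 17 := pr_of_count (by norm_num) (by decide +kernel)
  have h7 : pr 7 = 19 := pr_of_count (by norm_num) (by decide +kernel)
  have h8 : pr 8 = 23 := pr_of_count (by norm_num) (by decide +kernel)
  have h9 : pr 9 = 29 := pr_of_count (by norm_num) (by decide +kernel)
  have h10 : pr 10 = 31 := pr_of_count (by norm_num) (by decide +kernel)
  have h11 : pr 11 = 37 := pr_of_count (by norm_num) (by decide +kernel)
  have h12 : pr 12 = 41 := pr_of_count (by norm_num) (by decide +kernel)
  have h13 : pr 13 = 43 := pr_of_count (by norm_num) (by decide +kernel)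
  have h14 : pr 14 = 47 := pr_of_count (by norm_num) (by decide +kernel)
  have h15 : pr 15 = 53 := pr_of_count (by norm_num) (by decide +kernel)
  have h16 : pr 16 = 59 := pr_of_count (by norm_num) (by decide +kernel)
  have h17 : pr 17 = 61 := pr_of_count (by norm_num) (by decide +kernel)
  have h18 : pr 18 = 67 := pr_of_count (by norm_num) (by decide +kernel)
  have h19 : pr 19 = 71 := pr_of_count (by norm_num) (by decide +kernel)
  have h20 : pr 20 = 73 := pr_of_count (by norm_num) (by decide +kernel)
  have h21 : pr 21 = 79 := pr_of_count (by norm_num) (by decide +kernel)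
  have h22 : pr 22 = 83 := pr_of_count (by norm_num) (by decide +kernel)
  have h23 : pr 23 = 89 := pr_of_count (by norm_num) (by decide +kernel)
  have h24 : pr 24 = 97 := pr_of_count (by norm_num) (by decide +kernel)
  have h25 : pr 25 = 101 := pr_of_count (by norm_num) (by decide +kernel)
  have h26 : pr 26 = 103 := pr_of_count (by norm_num) (by decide +kernel)
  have h27 : pr 27 = 107 := pr_of_count (by norm_num) (by decide +kernel)
  have h28 : pr 28 = 109 := pr_of_count (by norm_num) (by decide +kernel)
  have h29 : pr 29 = 113 := pr_of_count (by norm_num) (by decide +kernel)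
  have h30 : pr 30 = 127 := pr_of_count (by norm_num) (by decide +kernel)
  have h31 : pr 31 = 131 := pr_of_count (by norm_num) (by decide +kernel)
  simp only [Finset.sum_range_succ, Finset.sum_range_zero, h0, h1, h2, h3, h4, h5, h6, h7, h8, h9, h10, h11, h12, h13, h14, h15, h16, h17, h18, h19, h20, h21, h22, h23, h24, h25, h26, h27, h28, h29, h30, h31]
  norm_num

lemma tsum_bounds : 3.67464 ≤ ∑' k : ℕ, (pr k : ℝ) / 2 ^ (k + 1) ∧ ∑' k : ℕ, (pr k : ℝ) / 2 ^ (k + 1) < 3.67465 := by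
  have h := summable_pr.sum_add_tsum_nat_add 32
  rw [partial_sum] at h
  have h1 : ∑' k : ℕ, (pr (k + 32) : ℝ) / 2 ^ (k + 32 + 1) ≤ 9 * (((32 : ℕ):ℝ) + 3) ^ 2 / 2 ^ 32 + 9 * (2 * (((32 : ℕ):ℝ) + 3) + 3) / 2 ^ 32 := by
    refine Real.tsum_le_of_sum_range_le (fun k => by positivity) (fun n => ?_)
    refine (tail_sum' 32 n).trans (le_of_eq ?_)
    ring
  have h2 : 0 ≤ ∑' k : ℕ, (pr (k + 32) : ℝ) / 2 ^ (k + 32 + 1) := tsum_nonneg (fun k => by positivity)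
  rw [← h]
  norm_num at h1 h2 ⊢
  constructor <;> linarith
end Erd

namespace Erd

def kk (x : ℕ) : ℕ := Nat.sqrt (Nat.log 2 x / 40) - 3

lemma log_atTop : Tendsto (fun x : ℕ => Nat.log 2 x) atTop atTop := by
  refine tendsto_atTop.2 fun b => ?_
  filter_upwards [eventually_ge_atTop (2 ^ b)] with x hx
  have : 0 < 2 ^ b := by positivity
  exact (Nat.le_log_iff_pow_le (by norm_num) (by omega)).2 hx

lemma kk_atTop : Tendsto kk atTop atTop := by
  refine tendsto_atTop.2 fun b => ?_
  filter_upwards [log_atTop.eventually_ge_atTop (40 * ((b + 3) * (b + 3)))] with x hx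
  have h1 : (b + 3) * (b + 3) ≤ Nat.log 2 x / 40 := by omega
  have h2 : b + 3 ≤ Nat.sqrt (Nat.log 2 x / 40) := Nat.le_sqrt.2 h1
  unfold kk
  omega

lemma kk_log : ∀ᶠ x : ℕ in atTop, 40 * (kk x + 3) ^ 2 ≤ Nat.log 2 x ∧ Nat.log 2 x < 40 * (kk x + 4) ^ 2 := by
  filter_upwards [log_atTop.eventually_ge_atTop 360] with x hx
  have h2 : 3 ≤ Nat.sqrt (Nat.log 2 x / 40) := Nat.le_sqrt.2 (by omega)
  have h3 := Nat.sqrt_le' (Nat.log 2 x / 40)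
  have h4 := Nat.lt_succ_sqrt' (Nat.log 2 x / 40)
  have h5 : kk x + 3 = Nat.sqrt (Nat.log 2 x / 40) := by unfold kk; omega
  rw [show kk x + 4 = Nat.sqrt (Nat.log 2 x / 40) + 1 by omega, h5]
  simp only [Nat.succ_eq_add_one] at h4
  omega

lemma kk_qm : ∀ᶠ x : ℕ in atTop, ∀ k ≤ kk x, qm k ^ 2 ≤ x := by
  filter_upwards [kk_log, eventually_gt_atTop 0] with x hx hx0 k hk
  have h1 := qm_le k
  have h2 : pr k ≤ 9 * (k + 3) ^ 2 := by exact_mod_cast pr_le k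
  have h3 : (k + 3) ^ 2 ≤ (kk x + 3) ^ 2 := Nat.pow_le_pow_left (by omega) 2
  have h4 : 0 < (k + 3) ^ 2 := by positivity
  calc qm k ^ 2 ≤ (4 ^ (pr k + 1)) ^ 2 := Nat.pow_le_pow_left h1 2
    _ = 2 ^ (4 * (pr k + 1)) := by
      rw [show (4:ℕ) = 2 ^ 2 by norm_num, ← pow_mul, ← pow_mul]; congr 1; ring
    _ ≤ 2 ^ Nat.log 2 x := Nat.pow_le_pow_right (by norm_num) (by omega)
    _ ≤ x := Nat.pow_log_le_self 2 (by omega)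

lemma big_le : ∀ᶠ x : ℕ in atTop, ∀ k ≤ kk x, ((big x k).card : ℝ) / Nat.primeCounting x ≤ 64 * pr k / 2 ^ k := by
  filter_upwards [kk_qm, pi_half, eventually_gt_atTop 2] with x hx hp hx2 k hk
  have h1 := big_bound x k (hx k hk)
  have hl : 0 < Real.log x := Real.log_pos (by exact_mod_cast (by omega : 1 < x))
  have hpi : (0:ℝ) < Nat.primeCounting x := by
    by_contra h
    have h0 : (Nat.primeCounting x : ℝ) = 0 := le_antisymm (not_lt.1 h) (by positivity)
    rw [h0] at hp
    have : (0:ℝ) < x := by exact_mod_cast (by omega : 0 < x)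
    linarith
  rw [div_le_iff₀ hpi]
  refine le_of_mul_le_mul_right (h1.trans ?_) hl
  calc 32 * (pr k:ℝ) * x / 2 ^ k ≤ 32 * (pr k:ℝ) * (2 * (Nat.primeCounting x * Real.log x)) / 2 ^ k := by gcongr
    _ = _ := by ring

lemma two_pow_sp (x : ℕ) (h : 1 ≤ Nat.log 2 x) : 2 ^ sp x ≤ 2 * Nat.log 2 x := by
  unfold sp
  rw [pow_succ, mul_comm]
  have := Nat.pow_log_le_self 2 (x := Nat.log 2 x) (by omega)
  omega

lemma middle : Tendsto (fun x : ℕ => 2 ^ (20 * sp x) * (((big x (kk x)).card : ℝ) / Nat.primeCounting x)) atTop (𝓝 0) := by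
  have h0 : Tendsto (fun x : ℕ => (80:ℝ) ^ 20 * 576 * 16 * (((kk x + 4 : ℕ):ℝ) ^ 42 / 2 ^ (kk x + 4))) atTop (𝓝 0) := by
    have := ((tendsto_pow_const_div_const_pow_of_one_lt 42 (r := (2:ℝ)) (by norm_num)).comp
      ((tendsto_add_atTop_nat 4).comp kk_atTop)).const_mul ((80:ℝ) ^ 20 * 576 * 16)
    rw [mul_zero] at this
    exact this
  refine squeeze_zero' (Eventually.of_forall fun x => by positivity) ?_ h0
  filter_upwards [big_le, kk_log, log_atTop.eventually_ge_atTop 1] with x h1 h2 h3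
  have h4 := h1 _ le_rfl
  have h5 : (2:ℝ) ^ sp x ≤ 80 * ((kk x + 4 : ℕ):ℝ) ^ 2 := by
    have := two_pow_sp x h3
    have : 2 ^ sp x ≤ 80 * (kk x + 4) ^ 2 := by omega
    exact_mod_cast this
  have h6 := pr_le (kk x)
  have h7 : (pr (kk x) : ℝ) ≤ 9 * ((kk x + 4 : ℕ):ℝ) ^ 2 := by
    refine h6.trans ?_
    push_cast
    gcongr
    norm_num
  calc 2 ^ (20 * sp x) * (((big x (kk x)).card : ℝ) / Nat.primeCounting x)
      ≤ (80 * ((kk x + 4 : ℕ):ℝ) ^ 2) ^ 20 * (64 * (9 * ((kk x + 4 : ℕ):ℝ) ^ 2) / 2 ^ kk x) := by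
        rw [mul_comm 20, pow_mul]
        refine mul_le_mul (pow_le_pow_left₀ (by positivity) h5 20) (h4.trans ?_) (by positivity) (by positivity)
        gcongr
    _ = _ := by
        rw [pow_add 2 (kk x) 4]
        set a := ((kk x + 4 : ℕ):ℝ)
        rw [mul_pow, ← pow_mul]
        field_simp
        ring

lemma huge_sum : Tendsto (fun x : ℕ => (∑ p ∈ huge x, (np p : ℝ)) / Nat.primeCounting x) atTop (𝓝 0) := by
  have h0 : Tendsto (fun x : ℕ => (16000:ℝ) * 2 * (((Nat.log 2 x / 5 + 1 : ℕ):ℝ) ^ 3 / 2 ^ (Nat.log 2 x / 5 + 1))) atTop (𝓝 0) := by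
    have h5 : Tendsto (fun n : ℕ => n / 5) atTop atTop := Nat.tendsto_div_const_atTop (by norm_num)
    have := ((tendsto_pow_const_div_const_pow_of_one_lt 3 (r := (2:ℝ)) (by norm_num)).comp
      ((tendsto_add_atTop_nat 1).comp (h5.comp log_atTop))).const_mul ((16000:ℝ) * 2)
    rw [mul_zero] at this
    exact this
  refine squeeze_zero' (Eventually.of_forall fun x => by positivity) ?_ h0
  filter_upwards [huge_card, pi_half, log_atTop.eventually_ge_atTop 1, eventually_gt_atTop 2] with x hc hp hL hx2
  set L := Nat.log 2 x with hLd
  have hxL : x < 2 ^ (L + 1) := Nat.lt_pow_succ_log_self (by norm_num) x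
  have hxL' : 2 ^ L ≤ x := Nat.pow_log_le_self 2 (by omega)
  have hnp : ∀ p ∈ huge x, np p ≤ 2 ^ (L / 2 + 1) := by
    intro p hpm
    obtain ⟨hpm, h2, -⟩ := Finset.mem_filter.1 hpm
    obtain ⟨hpx, hpp⟩ := Nat.mem_primesLE.1 hpm
    have h3 := np_sq hpp h2
    have h4 : (np p - 1) ^ 2 < (2 ^ (L / 2 + 1)) ^ 2 := by
      calc (np p - 1) ^ 2 < 2 ^ (L + 1) := by omega
        _ ≤ (2 ^ (L / 2 + 1)) ^ 2 := by
          rw [← pow_mul]; exact Nat.pow_le_pow_right (by norm_num) (by omega)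
    have := lt_of_pow_lt_pow_left₀ 2 (by positivity) h4
    omega
  have hsum : ∑ p ∈ huge x, np p ≤ 2 ^ (3 * L / 10 + 2 * sp x + 2) * 2 ^ (L / 2 + 1) := by
    refine (Finset.sum_le_card_nsmul _ _ _ hnp).trans ?_
    rw [smul_eq_mul]
    exact Nat.mul_le_mul_right _ hc
  have hs := two_pow_sp x hL
  have hsum2 : ∑ p ∈ huge x, np p ≤ 2 ^ (4 * L / 5) * (32 * L ^ 2) := by
    refine hsum.trans ?_
    calc 2 ^ (3 * L / 10 + 2 * sp x + 2) * 2 ^ (L / 2 + 1) = 2 ^ (3 * L / 10 + L / 2) * ((2 ^ sp x) ^ 2 * 8) := by ring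
      _ ≤ 2 ^ (4 * L / 5) * ((2 * L) ^ 2 * 8) := by
        gcongr
        · norm_num
        · omega
      _ = _ := by ring
  have hlog : Real.log x ≤ 2 * L := by
    have h1 : Real.log x ≤ Real.log (2 ^ (L + 1)) := Real.log_le_log (by exact_mod_cast (by omega : 0 < x)) (by exact_mod_cast hxL.le)
    rw [Real.log_pow] at h1
    have h2 := Real.log_two_lt_d9
    have h3 : (1:ℝ) ≤ L := by exact_mod_cast hL
    push_cast at h1
    nlinarith
  have hpiL : (2:ℝ) ^ L ≤ 4 * L * Nat.primeCounting x := by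
    calc (2:ℝ) ^ L ≤ x := by exact_mod_cast hxL'
      _ ≤ 2 * (Nat.primeCounting x * Real.log x) := hp
      _ ≤ 2 * (Nat.primeCounting x * (2 * L)) := by gcongr
      _ = _ := by ring
  have hpi : (0:ℝ) < Nat.primeCounting x := by
    by_contra h
    have h0 : (Nat.primeCounting x : ℝ) = 0 := le_antisymm (not_lt.1 h) (by positivity)
    rw [h0] at hpiL
    have : (0:ℝ) < 2 ^ L := by positivity
    linarith
  set m := L / 5 with hm
  have hLm : (L:ℝ) ≤ 5 * ((m + 1 : ℕ):ℝ) := by exact_mod_cast (by omega : L ≤ 5 * (m + 1))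
  have hsplit : (2:ℝ) ^ (4 * L / 5) * 2 ^ m ≤ 2 ^ L := by
    rw [← pow_add]; exact pow_le_pow_right₀ (by norm_num) (by omega)
  have hsum3 : (∑ p ∈ huge x, (np p:ℝ)) ≤ 2 ^ (4 * L / 5) * (32 * (L:ℝ) ^ 2) := by exact_mod_cast hsum2
  rw [div_le_iff₀ hpi]
  refine hsum3.trans ?_
  have h2m : (0:ℝ) < 2 ^ m := by positivity
  refine le_of_mul_le_mul_right ?_ h2m
  calc (2:ℝ) ^ (4 * L / 5) * (32 * (L:ℝ) ^ 2) * 2 ^ m = ((2:ℝ) ^ (4 * L / 5) * 2 ^ m) * (32 * (L:ℝ) ^ 2) := by ring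
    _ ≤ (4 * L * Nat.primeCounting x) * (32 * (L:ℝ) ^ 2) := 
        mul_le_mul_of_nonneg_right (hsplit.trans hpiL) (by positivity)
    _ = 128 * (L:ℝ) ^ 3 * Nat.primeCounting x := by ring
    _ ≤ 128 * (5 * ((m + 1 : ℕ):ℝ)) ^ 3 * Nat.primeCounting x := by gcongr
    _ = _ := by rw [pow_succ 2 m]; field_simp; ring

end Erd

namespace Erd

noncomputable def cnt (x k : ℕ) : ℕ := ((Nat.primesLE x).filter (fun p : ℕ => 2 < p ∧ np p = pr k)).card

lemma bound_summable : Summable (fun k : ℕ => 64 * (pr k : ℝ) ^ 2 / 2 ^ k) := by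
  have h := (summable_nat_add_iff 3).2 (summable_pow_mul_geometric_of_norm_lt_one 4 (r := (1/2:ℝ)) (by norm_num))
  refine Summable.of_nonneg_of_le (fun k => by positivity) (fun k => ?_) (h.mul_left (64 * 81 * 8))
  have h1 := pr_le k
  calc 64 * (pr k : ℝ) ^ 2 / 2 ^ k ≤ 64 * (9 * ((k:ℝ) + 3) ^ 2) ^ 2 / 2 ^ k := by gcongr
    _ = _ := by
      rw [one_div, inv_pow, pow_add]; push_cast; field_simp; ring

lemma main_part : Tendsto (fun x : ℕ => ∑ k ∈ Finset.range (kk x), (pr k : ℝ) * cnt x k / Nat.primeCounting x) atTop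
    (𝓝 (∑' k : ℕ, (pr k : ℝ) / 2 ^ (k + 1))) := by
  have h := tendsto_tsum_of_dominated_convergence (𝓕 := (atTop : Filter ℕ))
    (f := fun (x k : ℕ) => if k < kk x then (pr k : ℝ) * cnt x k / Nat.primeCounting x else 0)
    (g := fun k : ℕ => (pr k : ℝ) / 2 ^ (k + 1)) bound_summable ?_ ?_
  · refine h.congr fun x => ?_
    rw [tsum_eq_sum (s := Finset.range (kk x))]
    · exact Finset.sum_congr rfl fun k hk => if_pos (Finset.mem_range.1 hk)
    · intro k hk
      exact if_neg (fun h => hk (Finset.mem_range.2 h))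
  · intro k
    have h1 := (density_np k).const_mul (pr k : ℝ)
    rw [mul_one_div] at h1
    refine h1.congr' ?_
    filter_upwards [kk_atTop.eventually_gt_atTop k] with x hx
    rw [if_pos hx, mul_div_assoc]
    rfl
  · filter_upwards [big_le] with x hx k
    split_ifs with hk
    · rw [Real.norm_of_nonneg (by positivity), mul_div_assoc]
      have h1 := hx k hk.le
      have h2 : cnt x k ≤ (big x k).card := by
        refine Finset.card_le_card ?_
        intro p hp
        simp only [big, Finset.mem_filter] at hp ⊢
        exact ⟨hp.1, hp.2.1, hp.2.2.ge⟩
      have h3 : (cnt x k : ℝ) / Nat.primeCounting x ≤ 64 * pr k / 2 ^ k := by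
        refine le_trans ?_ h1
        gcongr
      calc (pr k : ℝ) * ((cnt x k : ℝ) / Nat.primeCounting x) ≤ pr k * (64 * pr k / 2 ^ k) := by gcongr
        _ = _ := by ring
    · rw [norm_zero]; positivity

lemma sum_cnt (x K : ℕ) : ∑ k ∈ Finset.range K, (pr k : ℝ) * cnt x k =
    ∑ p ∈ (Nat.primesLE x).filter (fun p => 2 < p), ∑ k ∈ Finset.range K, if np p = pr k then (np p : ℝ) else 0 := by
  rw [Finset.sum_comm]
  refine Finset.sum_congr rfl fun k _ => ?_
  rw [← Finset.sum_filter, Finset.filter_filter]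
  rw [Finset.sum_congr rfl (g := fun _ => (pr k : ℝ)) (fun p hp => by rw [(Finset.mem_filter.1 hp).2.2]), Finset.sum_const,
    nsmul_eq_mul, mul_comm]
  rfl

lemma inner_eq (K j : ℕ) : (∑ k ∈ Finset.range K, if pr j = pr k then (pr j : ℝ) else 0) = if j < K then (pr j : ℝ) else 0 := by
  simp only [pr_strictMono.injective.eq_iff]
  simp

lemma lower (x K : ℕ) : ∑ k ∈ Finset.range K, (pr k : ℝ) * cnt x k ≤ ∑ p ∈ (Nat.primesLE x).filter (fun p => 2 < p), (np p : ℝ) := by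
  rw [sum_cnt]
  refine Finset.sum_le_sum fun p hp => ?_
  obtain ⟨hp1, h2⟩ := Finset.mem_filter.1 hp
  obtain ⟨j, hj⟩ := exists_pr (np_prime (Nat.mem_primesLE.1 hp1).2 h2)
  rw [← hj, inner_eq]
  split_ifs
  · exact le_rfl
  · positivity

lemma upper (x K : ℕ) : ∑ p ∈ (Nat.primesLE x).filter (fun p => 2 < p), (np p : ℝ) ≤
    ∑ k ∈ Finset.range K, (pr k : ℝ) * cnt x k + 2 ^ (20 * sp x) * ((big x K).card : ℝ) + ∑ p ∈ huge x, (np p : ℝ) := by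
  have e1 : (2:ℝ) ^ (20 * sp x) * ((big x K).card : ℝ) =
      ∑ p ∈ (Nat.primesLE x).filter (fun p => 2 < p), if pr K ≤ np p then (2:ℝ) ^ (20 * sp x) else 0 := by
    rw [← Finset.sum_filter, Finset.filter_filter, Finset.sum_const, nsmul_eq_mul, mul_comm]; rfl
  have e2 : ∑ p ∈ huge x, (np p : ℝ) =
      ∑ p ∈ (Nat.primesLE x).filter (fun p => 2 < p), if 2 ^ (20 * sp x) < np p then (np p : ℝ) else 0 := by
    rw [← Finset.sum_filter, Finset.filter_filter]; rfl
  rw [sum_cnt, e1, e2, ← Finset.sum_add_distrib, ← Finset.sum_add_distrib]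
  refine Finset.sum_le_sum fun p hp => ?_
  obtain ⟨hp1, h2⟩ := Finset.mem_filter.1 hp
  obtain ⟨j, hj⟩ := exists_pr (np_prime (Nat.mem_primesLE.1 hp1).2 h2)
  rw [← hj, inner_eq]
  have hA : (0:ℝ) ≤ 2 ^ (20 * sp x) := by positivity
  have hB : (0:ℝ) ≤ pr j := by positivity
  by_cases h1 : j < K
  · rw [if_pos h1]
    split_ifs <;> linarith
  · rw [if_neg h1, if_pos (pr_strictMono.monotone (not_lt.1 h1))]
    split_ifs with h3
    · linarith
    · have : (pr j : ℝ) ≤ 2 ^ (20 * sp x) := by exact_mod_cast not_lt.1 h3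
      linarith

lemma final : Tendsto (fun x : ℕ => (∑ p ∈ (Nat.primesLE x).filter (fun p => 2 < p), (np p : ℝ)) / Nat.primeCounting x) atTop
    (𝓝 (∑' k : ℕ, (pr k : ℝ) / 2 ^ (k + 1))) := by
  have h2 := (main_part.add middle).add huge_sum
  rw [add_zero, add_zero] at h2
  refine tendsto_of_tendsto_of_tendsto_of_le_of_le main_part h2 (fun x => ?_) (fun x => ?_)
  · dsimp only
    rw [← Finset.sum_div]
    exact div_le_div_of_nonneg_right (lower x _) (by positivity)
  · dsimp only
    rw [← Finset.sum_div, ← mul_div_assoc, ← add_div, ← add_div]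
    exact div_le_div_of_nonneg_right (upper x _) (by positivity)

end Erd

end

/-- The average of the least quadratic nonresidue over primes exists and
equals `Σ_{n≥1} p_n/2^n = 3.67464…`; the series converges. Here `Nat.nth Nat.Prime m`
is the `(m+1)`-st prime, so `Σ_{n≥1} p_n/2^n = Σ_{m≥0} (Nat.nth Nat.Prime m)/2^{m+1}`. -/
theorem average_least_nonresidue :
    Summable (fun m : ℕ => (Nat.nth Nat.Prime m : ℝ) / 2 ^ (m + 1)) ∧
    Filter.Tendsto (fun x : ℕ =>
        (∑ p ∈ Finset.filter (fun p => p.Prime ∧ 2 < p) (Finset.range (x + 1)),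
          (leastQuadraticNonresidue p : ℝ)) / (Nat.primeCounting x : ℝ))
      Filter.atTop (nhds (∑' m : ℕ, (Nat.nth Nat.Prime m : ℝ) / 2 ^ (m + 1))) ∧
    3.67464 ≤ ∑' m : ℕ, (Nat.nth Nat.Prime m : ℝ) / 2 ^ (m + 1) ∧
    (∑' m : ℕ, (Nat.nth Nat.Prime m : ℝ) / 2 ^ (m + 1)) < 3.67465 := by
  refine ⟨Erd.summable_pr, ?_, Erd.tsum_bounds⟩
  have h := Erd.final
  refine h.congr fun x => ?_
  rw [Nat.primesLE_eq_filter_range, Finset.filter_filter]
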